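/- arXiv:hep-th/0406140 — 13 statements merged into one kernel-verified Lean document; each statement's English description precedes it below -/
import Mathlib

section
/- Let λ > 0 and p > 0. For α > 0 define G(α) = ∑_{k=0}^∞ 1/(½·e^{(2k+1)πλ} + α)^p. Then G(α) = O(α^{-p}·ln α) as α → ∞; that is, there exist constants C > 0 and α₀ > 1 such that G(α) ≤ C·α^{-p}·ln α for all α ≥ α₀. -/
open Real Filter

/-- For λ > 0, p > 0 and G(α) = ∑_{k=0}^∞ 1/(½·e^{(2k+1)πλ} + α)^p,
we have G(α) = O(α^{-p}·ln α) as α → ∞. -/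
theorem stmt_0 (lam p : ℝ) (hlam : 0 < lam) (hp : 0 < p) :
    ∃ C > (0 : ℝ), ∃ α₀ > (1 : ℝ), ∀ α ≥ α₀,
      (∑' k : ℕ, 1 / ((1 / 2) * Real.exp ((2 * (k : ℝ) + 1) * Real.pi * lam) + α) ^ p)
        ≤ C * α ^ (-p) * Real.log α := by
  have hpl : 0 < Real.pi * lam := mul_pos Real.pi_pos hlam
  obtain ⟨c, hc⟩ : ∃ c, c = 2 * (Real.pi * lam) := ⟨_, rfl⟩
  have hc0 : 0 < c := by rw [hc]; positivity
  obtain ⟨r, hr⟩ : ∃ r, r = Real.exp (-(c * p)) := ⟨_, rfl⟩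
  have hr0 : 0 < r := hr ▸ Real.exp_pos _
  have hr1 : r < 1 := by
    rw [hr, Real.exp_lt_one_iff]
    have := mul_pos hc0 hp
    linarith
  have hr2 : 0 < 1 - r := by linarith
  have h2p : (0 : ℝ) < 2 ^ p := by positivity
  refine ⟨1 / c + 1 + 2 ^ p * (1 - r)⁻¹, by positivity, Real.exp 1,
    Real.one_lt_exp_iff.2 one_pos, ?_⟩
  intro α hα
  have hα0 : 0 < α := lt_of_lt_of_le (Real.exp_pos _) hα
  have hlog : 1 ≤ Real.log α := (Real.le_log_iff_exp_le hα0).2 hα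
  have hap : 0 < α ^ (-p) := by positivity
  obtain ⟨f, hf⟩ : ∃ f : ℕ → ℝ, f = fun k : ℕ =>
    1 / ((1 / 2) * Real.exp ((2 * (k : ℝ) + 1) * Real.pi * lam) + α) ^ p := ⟨_, rfl⟩
  rw [← hf]
  have hf0 : ∀ k, 0 ≤ f k := fun k => by rw [hf]; positivity
  have key : ∀ (k : ℕ) (x : ℝ), 0 < x →
      x ≤ (1 / 2) * Real.exp ((2 * (k : ℝ) + 1) * Real.pi * lam) + α → f k ≤ x ^ (-p) := by
    intro k x hx h
    rw [hf, Real.rpow_neg hx.le, ← one_div]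
    exact one_div_le_one_div_of_le (by positivity) (Real.rpow_le_rpow hx.le h hp.le)
  have h1 : ∀ k, f k ≤ α ^ (-p) := fun k => key k α hα0 (by
    have := Real.exp_pos ((2 * (k : ℝ) + 1) * Real.pi * lam)
    linarith)
  obtain ⟨N, hN⟩ : ∃ N : ℕ, N = ⌈Real.log α / c⌉₊ := ⟨_, rfl⟩
  have hN1 : Real.log α / c ≤ N := hN ▸ Nat.le_ceil _
  have hN2 : (N : ℝ) < Real.log α / c + 1 := hN ▸ Nat.ceil_lt_add_one (by positivity)
  have hN3 : Real.log α ≤ N * c := (div_le_iff₀ hc0).1 hN1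
  have h2 : ∀ j, f (j + N) ≤ 2 ^ p * α ^ (-p) * r ^ j := by
    intro j
    have e : ((1 / 2) * (α * Real.exp (c * j))) ^ (-p) = 2 ^ p * α ^ (-p) * r ^ j := by
      rw [Real.mul_rpow (by positivity) (by positivity),
        Real.mul_rpow (by positivity) (by positivity), ← Real.exp_mul, hr, ← Real.exp_nat_mul,
        one_div, Real.inv_rpow (by positivity), Real.rpow_neg (by positivity), inv_inv,
        show c * (j : ℝ) * -p = (j : ℝ) * -(c * p) by ring]
      ring
    rw [← e]
    apply key _ _ (by positivity)
    have : α * Real.exp (c * j) ≤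
        Real.exp ((2 * ((j + N : ℕ) : ℝ) + 1) * Real.pi * lam) := by
      conv_lhs => rw [← Real.exp_log hα0]
      rw [← Real.exp_add, Real.exp_le_exp]
      push_cast
      rw [hc] at hN3 ⊢
      nlinarith
    linarith
  have hgs : Summable fun j : ℕ => 2 ^ p * α ^ (-p) * r ^ j :=
    (summable_geometric_of_lt_one hr0.le hr1).mul_left _
  have hs' : Summable fun j => f (j + N) := Summable.of_nonneg_of_le (fun j => hf0 _) h2 hgs
  have hs : Summable f := (summable_nat_add_iff N).1 hs'
  rw [← hs.sum_add_tsum_nat_add N]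
  have b1 : ∑ i ∈ Finset.range N, f i ≤ N * α ^ (-p) := by
    have := Finset.sum_le_card_nsmul (Finset.range N) f (α ^ (-p)) (fun i _ => h1 i)
    simpa using this
  have b2 : ∑' j, f (j + N) ≤ 2 ^ p * α ^ (-p) * (1 - r)⁻¹ := by
    rw [← tsum_geometric_of_lt_one hr0.le hr1, ← tsum_mul_left]
    exact hs'.tsum_le_tsum h2 hgs
  have hK : 0 < 2 ^ p * (1 - r)⁻¹ := by positivity
  calc _ ≤ N * α ^ (-p) + 2 ^ p * α ^ (-p) * (1 - r)⁻¹ := add_le_add b1 b2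
    _ = (N + 2 ^ p * (1 - r)⁻¹) * α ^ (-p) := by ring
    _ ≤ ((1 / c + 1 + 2 ^ p * (1 - r)⁻¹) * Real.log α) * α ^ (-p) := by
        apply mul_le_mul_of_nonneg_right _ hap.le
        have e : Real.log α / c = 1 / c * Real.log α := by ring
        nlinarith
    _ = _ := by ring
end

section
/- Let λ > 0 and p > 0. For α > 0 define F(α) = ∑_{k=0}^∞ 1/(cosh((2k+1)πλ) + α)^p and G(α) = ∑_{k=0}^∞ 1/(½·e^{(2k+1)πλ} + α)^p. Then F(α) = G(α) + O(α^{-(p+1)}) as α → ∞; that is, there exist constants C > 0 and α₀ > 0 such that |F(α) − G(α)| ≤ C·α^{-(p+1)} for all α ≥ α₀. -/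
open Real Filter

lemma aux_summable (c : ℝ) (hc : 0 < c) :
    Summable (fun k : ℕ => Real.exp (-(c * (2 * (k : ℝ) + 1)))) := by
  have h : Summable (fun k : ℕ => Real.exp (-c) * (Real.exp (-(2 * c))) ^ k) := by
    apply Summable.mul_left
    apply summable_geometric_of_lt_one (Real.exp_pos _).le
    rw [Real.exp_lt_one_iff]
    linarith
  refine h.congr ?_
  intro k
  rw [← Real.exp_nat_mul, ← Real.exp_add]
  congr 1
  ring

lemma aux_ineq (p b d : ℝ) (hp : 0 < p) (hb : 0 < b) (hd : 0 ≤ d) :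
    1 / b ^ p - 1 / (b + d) ^ p ≤ p * d * b ^ (-(p + 1)) := by
  have hs : 0 < 1 + d / b := by positivity
  have h1 : b + d = b * (1 + d / b) := by field_simp
  have h2 : 1 - p * (d / b) ≤ (1 + d / b) ^ (-p) := by
    rw [Real.rpow_def_of_pos hs]
    have h3 := Real.add_one_le_exp (Real.log (1 + d / b) * -p)
    have h4 := Real.log_le_sub_one_of_pos hs
    nlinarith
  have e1 : 1 / (b + d) ^ p = b ^ (-p) * (1 + d / b) ^ (-p) := by
    rw [one_div, ← Real.rpow_neg (by positivity), h1, Real.mul_rpow hb.le hs.le]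
  have e2 : 1 / b ^ p = b ^ (-p) := by
    rw [one_div, ← Real.rpow_neg hb.le]
  have e3 : b ^ (-(p + 1)) = b ^ (-p) * b⁻¹ := by
    rw [neg_add, Real.rpow_add hb, Real.rpow_neg_one]
  rw [e1, e2, e3]
  have h5 : 0 < b ^ (-p) := by positivity
  have h6 := mul_le_mul_of_nonneg_left h2 h5.le
  have h7 : p * d * (b ^ (-p) * b⁻¹) = b ^ (-p) * (p * (d / b)) := by
    rw [div_eq_mul_inv]; ring
  rw [h7]
  linarith

/-- For λ > 0, p > 0,
F(α) = ∑_{k=0}^∞ 1/(cosh((2k+1)πλ) + α)^p and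
G(α) = ∑_{k=0}^∞ 1/(½·e^{(2k+1)πλ} + α)^p satisfy
F(α) = G(α) + O(α^{-(p+1)}) as α → ∞. -/
theorem stmt_1 (lam p : ℝ) (hlam : 0 < lam) (hp : 0 < p) :
    ∃ C > (0 : ℝ), ∃ α₀ > (0 : ℝ), ∀ α ≥ α₀,
      |(∑' k : ℕ, 1 / (Real.cosh ((2 * (k : ℝ) + 1) * Real.pi * lam) + α) ^ p)
        - (∑' k : ℕ, 1 / ((1 / 2) * Real.exp ((2 * (k : ℝ) + 1) * Real.pi * lam) + α) ^ p)|
        ≤ C * α ^ (-(p + 1)) := by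
  have hc : 0 < Real.pi * lam := by positivity
  have hS := aux_summable _ hc
  refine ⟨p * ∑' k : ℕ, Real.exp (-(Real.pi * lam * (2 * (k : ℝ) + 1))),
    mul_pos hp (hS.tsum_pos (fun k => (Real.exp_pos _).le) 0 (Real.exp_pos _)), 1, one_pos, ?_⟩
  intro α hα
  have hα0 : 0 < α := by linarith
  have hcosh : ∀ k : ℕ, Real.cosh ((2 * (k : ℝ) + 1) * Real.pi * lam) + α =
      ((1 / 2) * Real.exp ((2 * (k : ℝ) + 1) * Real.pi * lam) + α)
        + (1 / 2) * Real.exp (-(Real.pi * lam * (2 * (k : ℝ) + 1))) := by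
    intro k
    rw [Real.cosh_eq, show -(Real.pi * lam * (2 * (k : ℝ) + 1))
      = -((2 * (k : ℝ) + 1) * Real.pi * lam) by ring]
    ring
  have hG : Summable (fun k : ℕ =>
      1 / ((1 / 2) * Real.exp ((2 * (k : ℝ) + 1) * Real.pi * lam) + α) ^ p) := by
    have h := (aux_summable (p * (Real.pi * lam)) (by positivity)).mul_left ((1 / 2 : ℝ) ^ (-p))
    refine Summable.of_nonneg_of_le (fun k => by positivity) (fun k => ?_) h
    have e : (1 / 2 : ℝ) ^ (-p) * Real.exp (-(p * (Real.pi * lam) * (2 * (k : ℝ) + 1)))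
        = 1 / ((1 / 2) * Real.exp ((2 * (k : ℝ) + 1) * Real.pi * lam)) ^ p := by
      rw [one_div (_ ^ p), ← Real.rpow_neg (by positivity),
        Real.mul_rpow (by norm_num) (Real.exp_pos _).le, ← Real.exp_mul]
      congr 2
      ring
    rw [e]
    apply one_div_le_one_div_of_le (by positivity)
    apply Real.rpow_le_rpow (by positivity) (by linarith) hp.le
  have hle : ∀ k : ℕ, 1 / (Real.cosh ((2 * (k : ℝ) + 1) * Real.pi * lam) + α) ^ p ≤
      1 / ((1 / 2) * Real.exp ((2 * (k : ℝ) + 1) * Real.pi * lam) + α) ^ p := by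
    intro k
    rw [hcosh]
    apply one_div_le_one_div_of_le (by positivity)
    apply Real.rpow_le_rpow (by positivity) _ hp.le
    have := Real.exp_pos (-(Real.pi * lam * (2 * (k : ℝ) + 1)))
    linarith
  have hF : Summable (fun k : ℕ =>
      1 / (Real.cosh ((2 * (k : ℝ) + 1) * Real.pi * lam) + α) ^ p) := by
    refine Summable.of_nonneg_of_le (fun k => ?_) hle hG
    rw [hcosh]
    positivity
  rw [abs_sub_comm, ← hG.tsum_sub hF,
    abs_of_nonneg (tsum_nonneg fun k => sub_nonneg.2 (hle k)), ← tsum_mul_left, ← tsum_mul_right]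
  refine (hG.sub hF).tsum_le_tsum (fun k => ?_) ((hS.mul_left p).mul_right _)
  rw [hcosh]
  refine (aux_ineq p _ _ hp (by positivity) (by positivity)).trans ?_
  have hE := Real.exp_pos (-(Real.pi * lam * (2 * (k : ℝ) + 1)))
  apply mul_le_mul
  · nlinarith
  · apply Real.rpow_le_rpow_of_nonpos hα0
    · have := Real.exp_pos ((2 * (k : ℝ) + 1) * Real.pi * lam)
      linarith
    · linarith
  · positivity
  · positivity
end

section
/- Let λ > 0 and p > 0, and for x > 0 define I(x) = ∫_0^∞ dt/(e^{2πλt} + x)^p. Then, as x → ∞, 2πλ·x^p·I(x) = ln x + c_p + O(x^{-1}), where c_p = ∫_0^∞ (1/z)·[(1+z)^{-p} − (1+z)^{-1}] dz; in particular there exist C > 0 and x₀ > 0 such that |2πλ·x^p·I(x) − ln x − c_p| ≤ C/x for x ≥ x₀. -/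
open Real Filter MeasureTheory

lemma aux_low (q z : ℝ) (hq : 0 < q) (hz : 0 < z) :
    1 - q * z ≤ (1 + z) ^ (-q) ∧ (1 + z) ^ (-q) ≤ 1 := by
  constructor
  · rw [Real.rpow_def_of_pos (by linarith)]
    have h1 := Real.add_one_le_exp (Real.log (1 + z) * -q)
    have h2 := Real.log_le_sub_one_of_pos (show 0 < 1 + z by linarith)
    nlinarith
  · exact Real.rpow_le_one_of_one_le_of_nonpos (by linarith) (by linarith)

lemma aux_bound (p z : ℝ) (hp : 0 < p) (hz : 0 < z) :
    ‖(1 / z) * ((1 + z) ^ (-p) - (1 + z) ^ (-(1 : ℝ)))‖ ≤ p + 1 := by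
  obtain ⟨h1, h2⟩ := aux_low p z hp hz
  obtain ⟨h3, h4⟩ := aux_low 1 z one_pos hz
  rw [norm_mul, Real.norm_eq_abs, Real.norm_eq_abs, abs_of_pos (by positivity : 0 < 1 / z),
    one_div, inv_mul_le_iff₀ hz, abs_le]
  have := mul_pos hp hz
  constructor <;> nlinarith

lemma aux_meas (p : ℝ) :
    Measurable (fun z : ℝ => (1 / z) * ((1 + z) ^ (-p) - (1 + z) ^ (-(1 : ℝ)))) := by
  fun_prop

lemma aux_int (p : ℝ) (hp : 0 < p) :
    IntegrableOn (fun z : ℝ => (1 / z) * ((1 + z) ^ (-p) - (1 + z) ^ (-(1 : ℝ))))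
      (Set.Ioi 0) := by
  rw [← Set.Ioc_union_Ioi_eq_Ioi (zero_le_one' ℝ)]
  refine IntegrableOn.union ?_ ?_
  · refine Measure.integrableOn_of_bounded (M := p + 1) (by simp)
      (aux_meas p).aestronglyMeasurable ?_
    filter_upwards [ae_restrict_mem measurableSet_Ioc] with z hz
    exact aux_bound p z hp hz.1
  · have hi : IntegrableOn (fun z : ℝ => z ^ (-1 - p) + z ^ (-2 : ℝ)) (Set.Ioi 1) :=
      (integrableOn_Ioi_rpow_of_lt (by linarith) one_pos).add
        (integrableOn_Ioi_rpow_of_lt (by norm_num) one_pos)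
    refine Integrable.mono' hi (aux_meas p).aestronglyMeasurable ?_
    filter_upwards [ae_restrict_mem measurableSet_Ioi] with z hz
    have hz1 : (1 : ℝ) < z := hz
    have hz0 : 0 < z := by linarith
    have key : ∀ q : ℝ, 0 < q → (1 / z) * (1 + z) ^ (-q) ≤ z ^ (-1 - q) := by
      intro q hq
      rw [sub_eq_add_neg, Real.rpow_add hz0, Real.rpow_neg_one, one_div]
      gcongr ?_ * ?_
      exact Real.rpow_le_rpow_of_nonpos hz0 (by linarith) (by linarith)
    have k1 := key p hp
    have k2 := key 1 one_pos
    rw [show (-1 - 1 : ℝ) = -2 by norm_num] at k2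
    have n1 : 0 ≤ (1 / z) * (1 + z) ^ (-p) := by positivity
    have n2 : 0 ≤ (1 / z) * (1 + z) ^ (-(1 : ℝ)) := by positivity
    rw [mul_sub, Real.norm_eq_abs, abs_le]
    constructor <;> linarith

lemma aux_log (x : ℝ) (hx : 0 < x) :
    IntegrableOn (fun z : ℝ => (1 / z) * (1 + z) ^ (-(1 : ℝ))) (Set.Ioi (1 / x)) ∧
    ∫ z in Set.Ioi (1 / x), (1 / z) * (1 + z) ^ (-(1 : ℝ)) = Real.log (1 + x) := by
  have hx' : 0 < 1 / x := by positivity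
  have hd : ∀ z ∈ Set.Ici (1 / x), HasDerivAt (fun z : ℝ => - Real.log (1 + z⁻¹))
      ((1 / z) * (1 + z) ^ (-(1 : ℝ))) z := by
    intro z hz
    have hz0 : 0 < z := lt_of_lt_of_le hx' hz
    have h1 := (((hasDerivAt_inv hz0.ne').const_add 1).log (by positivity)).neg
    have h2 : (1 / z) * (1 + z) ^ (-(1 : ℝ)) = -(-(z ^ 2)⁻¹ / (1 + z⁻¹)) := by
      rw [Real.rpow_neg_one]
      field_simp
      ring
    rw [h2]
    exact h1
  have hn : ∀ z ∈ Set.Ioi (1 / x), 0 ≤ (1 / z) * (1 + z) ^ (-(1 : ℝ)) := by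
    intro z hz
    have hz0 : 0 < z := lt_trans hx' hz
    positivity
  have ht : Tendsto (fun z : ℝ => - Real.log (1 + z⁻¹)) atTop (nhds 0) := by
    have h0 : Tendsto (fun z : ℝ => 1 + z⁻¹) atTop (nhds (1 + 0)) :=
      tendsto_inv_atTop_zero.const_add 1
    have h2 := (h0.log (by norm_num)).neg
    simpa using h2
  have hi := integrableOn_Ioi_deriv_of_nonneg' hd hn ht
  refine ⟨hi, ?_⟩
  rw [integral_Ioi_of_hasDerivAt_of_tendsto' hd hi ht]
  simp

lemma aux_subst (a p x : ℝ) (ha : 0 < a) (hx : 0 < x) :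
    a * x ^ p * (∫ t in Set.Ioi (0 : ℝ), 1 / (Real.exp (a * t) + x) ^ p) =
      ∫ z in Set.Ioi (1 / x), (1 / z) * (1 + z) ^ (-p) := by
  have him : (fun t : ℝ => Real.exp (a * t) / x) '' Set.Ioi 0 = Set.Ioi (1 / x) := by
    ext z
    simp only [Set.mem_image, Set.mem_Ioi]
    constructor
    · rintro ⟨t, ht, rfl⟩
      gcongr
      exact Real.one_lt_exp_iff.2 (by positivity)
    · intro hz
      have h1 : 1 < z * x := (div_lt_iff₀ hx).1 hz
      refine ⟨Real.log (z * x) / a, div_pos (Real.log_pos h1) ha, ?_⟩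
      rw [mul_div_cancel₀ _ ha.ne', Real.exp_log (by linarith)]
      field_simp
  have hinj : Set.InjOn (fun t : ℝ => Real.exp (a * t) / x) (Set.Ioi 0) := by
    intro s _ t _ h
    have h1 : Real.exp (a * s) = Real.exp (a * t) := (div_left_inj' hx.ne').1 h
    exact mul_left_cancel₀ ha.ne' (Real.exp_injective h1)
  have hd : ∀ t ∈ Set.Ioi (0 : ℝ), HasDerivWithinAt (fun t : ℝ => Real.exp (a * t) / x)
      (Real.exp (a * t) * a / x) (Set.Ioi 0) t := by
    intro t _
    have h1 := ((((hasDerivAt_id t).const_mul a).exp).div_const x).hasDerivWithinAt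
      (s := Set.Ioi 0)
    simpa using h1
  rw [← him, integral_image_eq_integral_abs_deriv_smul measurableSet_Ioi hd hinj,
    ← integral_const_mul]
  refine setIntegral_congr_fun measurableSet_Ioi ?_
  intro t _
  have he := Real.exp_pos (a * t)
  simp only [smul_eq_mul]
  rw [abs_of_pos (by positivity),
    show 1 + Real.exp (a * t) / x = (Real.exp (a * t) + x) / x by field_simp; ring,
    Real.rpow_neg (by positivity), Real.div_rpow (by positivity) hx.le]
  have := Real.rpow_pos_of_pos hx p
  have := Real.rpow_pos_of_pos (add_pos he hx) p
  field_simp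

/-- For λ > 0, p > 0 and I(x) = ∫_0^∞ dt/(e^{2πλt} + x)^p, as x → ∞,
2πλ·x^p·I(x) = ln x + c_p + O(x^{-1}), where
c_p = ∫_0^∞ (1/z)·[(1+z)^{-p} − (1+z)^{-1}] dz. -/
theorem stmt_4 (lam p : ℝ) (hlam : 0 < lam) (hp : 0 < p) :
    ∃ C > (0 : ℝ), ∃ x₀ > (0 : ℝ), ∀ x ≥ x₀,
      |2 * Real.pi * lam * x ^ p *
          (∫ t in Set.Ioi (0 : ℝ), 1 / (Real.exp (2 * Real.pi * lam * t) + x) ^ p)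
        - Real.log x
        - ∫ z in Set.Ioi (0 : ℝ), (1 / z) * ((1 + z) ^ (-p) - (1 + z) ^ (-(1 : ℝ)))|
        ≤ C / x := by
  refine ⟨p + 2, by linarith, 1, one_pos, ?_⟩
  intro x hx1
  have hx : 0 < x := by linarith
  have hx' : 0 < 1 / x := by positivity
  rw [aux_subst (2 * Real.pi * lam) p x (by positivity) hx]
  obtain ⟨hl1, hl2⟩ := aux_log x hx
  have hI := aux_int p hp
  have hI1 := hI.mono_set (Set.Ioi_subset_Ioi hx'.le)
  have hI2 := hI.mono_set (fun z (hz : z ∈ Set.Ioc 0 (1 / x)) => hz.1)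
  have e1 : ∫ z in Set.Ioi (1 / x), (1 / z) * (1 + z) ^ (-p) =
      (∫ z in Set.Ioi (1 / x), (1 / z) * ((1 + z) ^ (-p) - (1 + z) ^ (-(1 : ℝ))))
        + Real.log (1 + x) := by
    rw [← hl2, ← integral_add hI1 hl1]
    refine setIntegral_congr_fun measurableSet_Ioi ?_
    intro z _
    simp only
    ring
  have e2 : ∫ z in Set.Ioi (0 : ℝ), (1 / z) * ((1 + z) ^ (-p) - (1 + z) ^ (-(1 : ℝ))) =
      (∫ z in Set.Ioc 0 (1 / x), (1 / z) * ((1 + z) ^ (-p) - (1 + z) ^ (-(1 : ℝ)))) +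
      ∫ z in Set.Ioi (1 / x), (1 / z) * ((1 + z) ^ (-p) - (1 + z) ^ (-(1 : ℝ))) := by
    rw [← setIntegral_union Set.Ioc_disjoint_Ioi_same measurableSet_Ioi hI2 hI1,
      Set.Ioc_union_Ioi_eq_Ioi hx'.le]
  have b : ‖∫ z in Set.Ioc 0 (1 / x), (1 / z) * ((1 + z) ^ (-p) - (1 + z) ^ (-(1 : ℝ)))‖
      ≤ (p + 1) * (volume.real (Set.Ioc 0 (1 / x))) :=
    norm_setIntegral_le_of_norm_le_const (by simp) (fun z hz => aux_bound p z hp hz.1)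
  rw [Real.volume_real_Ioc_of_le hx'.le, sub_zero, Real.norm_eq_abs, abs_le] at b
  have l1 : Real.log (1 + x) - Real.log x = Real.log (1 + 1 / x) := by
    rw [← Real.log_div (by positivity) hx.ne']
    congr 1
    field_simp
    ring
  have l2 := Real.log_le_sub_one_of_pos (show 0 < 1 + 1 / x by positivity)
  have l3 := Real.log_nonneg (show 1 ≤ 1 + 1 / x by linarith)
  have l4 : (p + 2) / x = (p + 1) * (1 / x) + 1 / x := by ring
  rw [e1, e2, l4, abs_le]
  constructor <;> linarith [b.1, b.2]
end

section
/- Let p > 1/2. Then, as v → ∞, ∑_{m=1}^∞ 1/(m² + v²)^p = (√π·Γ(p − ½))/(2·Γ(p)) · v^{-(2p−1)} + O(v^{-2p}); that is, there exist C > 0 and v₀ > 0 such that |∑_{m=1}^∞ (m² + v²)^{-p} − (√π·Γ(p − ½))/(2·Γ(p))·v^{1−2p}| ≤ C·v^{-2p} for v ≥ v₀. -/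
open Real Filter

lemma lint_of_int (f : ℝ → ℝ) (c : ℝ) (hc : 0 < c) (h0 : ∀ t ∈ Set.Ioi (0 : ℝ), 0 ≤ f t)
    (h : ∫ t in Set.Ioi (0 : ℝ), f t = c) :
    ∫⁻ t in Set.Ioi (0 : ℝ), ENNReal.ofReal (f t) = ENNReal.ofReal c := by
  have hi : MeasureTheory.Integrable f (MeasureTheory.volume.restrict (Set.Ioi (0 : ℝ))) :=
    .of_integral_ne_zero (by rw [h]; exact hc.ne')
  rw [← MeasureTheory.ofReal_integral_eq_lintegral_ofReal hi, h]
  filter_upwards [MeasureTheory.ae_restrict_mem measurableSet_Ioi] with t ht using h0 t ht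

lemma lint_main (p : ℝ) (hp : 1 / 2 < p) (v : ℝ) (hv : 0 < v) :
    ∫⁻ x in Set.Ioi (0 : ℝ), ENNReal.ofReal ((1 / (x ^ 2 + v ^ 2)) ^ p * Gamma p)
      = ENNReal.ofReal (√π / 2 * ((1 / v ^ 2) ^ (p - 1 / 2) * Gamma (p - 1 / 2))) := by
  have hG : 0 < Gamma p := Gamma_pos_of_pos (by linarith)
  have hG' : 0 < Gamma (p - 1 / 2) := Gamma_pos_of_pos (by linarith)
  have h1 : ∀ x : ℝ, ENNReal.ofReal ((1 / (x ^ 2 + v ^ 2)) ^ p * Gamma p) =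
      ∫⁻ t in Set.Ioi (0 : ℝ), ENNReal.ofReal (t ^ (p - 1) * exp (-((x ^ 2 + v ^ 2) * t))) := by
    intro x
    refine (lint_of_int _ _ (by positivity) (fun t ht => ?_)
      (integral_rpow_mul_exp_neg_mul_Ioi (by linarith) (by positivity))).symm
    have : 0 < t := ht
    positivity
  have h2 : ∀ t ∈ Set.Ioi (0 : ℝ),
      ∫⁻ x in Set.Ioi (0 : ℝ), ENNReal.ofReal (t ^ (p - 1) * exp (-((x ^ 2 + v ^ 2) * t))) =
      ENNReal.ofReal (√π / 2 * (t ^ (p - 1 / 2 - 1) * exp (-(v ^ 2 * t)))) := by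
    intro t ht
    have ht : 0 < t := ht
    refine lint_of_int _ _ (by positivity) (fun x _ => by positivity) ?_
    have e : ∀ x : ℝ, t ^ (p - 1) * exp (-((x ^ 2 + v ^ 2) * t)) =
        (t ^ (p - 1) * exp (-(v ^ 2 * t))) * exp (-t * x ^ 2) := by
      intro x
      rw [mul_assoc, ← exp_add]
      ring_nf
    simp_rw [e]
    rw [MeasureTheory.integral_const_mul, integral_gaussian_Ioi, sqrt_div pi_pos.le,
      show p - 1 / 2 - 1 = (p - 1) - 1 / 2 by ring, rpow_sub ht (p - 1) (1 / 2), ← sqrt_eq_rpow]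
    ring
  simp_rw [h1]
  rw [MeasureTheory.lintegral_lintegral_swap, MeasureTheory.setLIntegral_congr_fun measurableSet_Ioi h2]
  · refine lint_of_int _ _ (by positivity) (fun t ht => ?_) ?_
    · have : 0 < t := ht
      positivity
    · rw [MeasureTheory.integral_const_mul,
        integral_rpow_mul_exp_neg_mul_Ioi (by linarith) (by positivity)]
  · apply Measurable.aemeasurable
    unfold Function.uncurry
    fun_prop

lemma int_main (p : ℝ) (hp : 1 / 2 < p) (v : ℝ) (hv : 0 < v) :
    MeasureTheory.IntegrableOn (fun x : ℝ => 1 / (x ^ 2 + v ^ 2) ^ p) (Set.Ioi 0) ∧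
    ∫ x in Set.Ioi (0 : ℝ), 1 / (x ^ 2 + v ^ 2) ^ p
      = √π * Gamma (p - 1 / 2) / (2 * Gamma p) * v ^ (1 - 2 * p) := by
  have hG : 0 < Gamma p := Gamma_pos_of_pos (by linarith)
  have hG' : 0 < Gamma (p - 1 / 2) := Gamma_pos_of_pos (by linarith)
  have key : ∫ x in Set.Ioi (0 : ℝ), (1 / (x ^ 2 + v ^ 2)) ^ p * Gamma p
      = √π / 2 * ((1 / v ^ 2) ^ (p - 1 / 2) * Gamma (p - 1 / 2)) := by
    rw [MeasureTheory.integral_eq_lintegral_of_nonneg_ae, lint_main p hp v hv,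
      ENNReal.toReal_ofReal (by positivity)]
    · exact Eventually.of_forall fun x => by positivity
    · apply Measurable.aestronglyMeasurable
      fun_prop
  have e : ∀ x : ℝ, (1 / (x ^ 2 + v ^ 2)) ^ p = 1 / (x ^ 2 + v ^ 2) ^ p := fun x => by
    rw [div_rpow zero_le_one (by positivity), one_rpow]
  simp_rw [e] at key
  have ev : (1 / v ^ 2) ^ (p - 1 / 2) = v ^ (1 - 2 * p) := by
    rw [one_div, inv_rpow (by positivity), ← rpow_neg (by positivity), ← rpow_natCast,
      ← rpow_mul hv.le]
    congr 1
    push_cast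
    ring
  rw [MeasureTheory.integral_mul_const, ev] at key
  have hval : ∫ x in Set.Ioi (0 : ℝ), 1 / (x ^ 2 + v ^ 2) ^ p
      = √π * Gamma (p - 1 / 2) / (2 * Gamma p) * v ^ (1 - 2 * p) := by
    rw [eq_comm, ← mul_left_inj' hG.ne', key]
    field_simp
  refine ⟨?_, hval⟩
  refine MeasureTheory.Integrable.of_integral_ne_zero ?_
  rw [hval]
  positivity

/-- For p > 1/2, as v → ∞,
∑_{m=1}^∞ 1/(m² + v²)^p = (√π·Γ(p−½))/(2Γ(p)) · v^{-(2p−1)} + O(v^{-2p}). -/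
theorem stmt_6 (p : ℝ) (hp : 1 / 2 < p) :
    ∃ C > (0 : ℝ), ∃ v₀ > (0 : ℝ), ∀ v ≥ v₀,
      |(∑' m : ℕ, 1 / (((m : ℝ) + 1) ^ 2 + v ^ 2) ^ p)
        - Real.sqrt Real.pi * Real.Gamma (p - 1 / 2) / (2 * Real.Gamma p)
            * v ^ (1 - 2 * p)|
        ≤ C * v ^ (-(2 * p)) := by
  refine ⟨1, one_pos, 1, one_pos, fun v hv1 => ?_⟩
  have hv : 0 < v := by linarith
  obtain ⟨hint, hval⟩ := int_main p hp v hv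
  set f : ℝ → ℝ := fun x : ℝ => 1 / (x ^ 2 + v ^ 2) ^ p with hf
  have hnn : ∀ t ∈ Set.Ioi (0 : ℝ), 0 ≤ f t := fun t _ => by positivity
  have anti : AntitoneOn f (Set.Ici 0) := by
    intro a ha b hb hab
    have ha : 0 ≤ a := ha
    have hp0 : 0 ≤ p := by linarith
    simp only [hf]
    gcongr
  have hs := anti.summable_of_integrableOn_Ioi_zero hint hnn
  have hu := anti.tsum_add_one_le_integral hint hnn
  have hl := anti.integral_le_tsum hs hnn
  rw [hs.tsum_eq_zero_add] at hl
  have h0 : f ((0 : ℕ) : ℝ) = v ^ (-(2 * p)) := by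
    simp only [hf]
    rw [rpow_neg hv.le, rpow_mul hv.le]
    simp
  rw [h0] at hl
  rw [hval] at hu hl
  have hS : (∑' m : ℕ, 1 / (((m : ℝ) + 1) ^ 2 + v ^ 2) ^ p) = ∑' n : ℕ, f ((n + 1 : ℕ) : ℝ) := by
    simp [hf]
  rw [hS, abs_le]
  have : 0 < v ^ (-(2 * p)) := by positivity
  constructor <;> linarith
end

section
/- Let m ≥ 0 be an integer and a > 0. Then ∫_a^∞ dr/(r^m·(r + a)·√(r² − a²)) = a^{-(m+1)} · ∑_{i=0}^m (−1)^i · ((m−i−2)!!/(m−i−1)!!) · (π/2)^{(1−(−1)^{m−i})/2}. -/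
open Real MeasureTheory Nat

/-- Summand of the formula, as a function of `k = m - i`. -/
noncomputable def auxT (k : ℕ) : ℝ :=
  ((Nat.doubleFactorial (k - 2) : ℝ) / (Nat.doubleFactorial (k - 1) : ℝ))
    * (Real.pi / 2) ^ ((1 - (-1 : ℝ) ^ k) / 2)

theorem auxT_rec (k : ℕ) : auxT (k + 3) = (k + 1) / (k + 2) * auxT (k + 1) := by
  unfold auxT
  have h1 : k + 3 - 2 = k + 1 := by omega
  have h2 : k + 3 - 1 = k + 2 := by omega
  have h3 : k + 1 - 1 = k := by omega
  have h4 : k + 1 - 2 = k - 1 := by omega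
  have h5 : (-1 : ℝ) ^ (k + 3) = (-1) ^ (k + 1) := by ring
  have h6 : (k + 1).doubleFactorial = (k + 1) * (k - 1).doubleFactorial := by
    cases k with
    | zero => simp
    | succ n => simp [Nat.doubleFactorial]
  have h7 : (k + 2).doubleFactorial = (k + 2) * k.doubleFactorial := rfl
  rw [h1, h2, h3, h4, h5, h6, h7]
  have h8 : (k.doubleFactorial : ℝ) ≠ 0 := by
    exact_mod_cast (Nat.doubleFactorial_pos k).ne'
  have h9 : (k : ℝ) + 2 ≠ 0 := by positivity
  push_cast
  field_simp

theorem cos_int (n : ℕ) : ∫ x in (0 : ℝ)..(π / 2), cos x ^ n = auxT (n + 1) := by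
  induction n using Nat.strong_induction_on with
  | _ n ih =>
    match n with
    | 0 => simp [auxT]
    | 1 => simp [auxT]
    | n + 2 =>
      rw [integral_cos_pow, ih n (by omega), auxT_rec]
      simp

theorem one_add_cos_pos {x : ℝ} (hx : x ∈ Set.Icc 0 (π / 2)) : 0 < 1 + cos x := by
  have := cos_nonneg_of_mem_Icc (x := x) ⟨by linarith [hx.1, pi_pos], hx.2⟩
  linarith

theorem J_int (m : ℕ) :
    IntervalIntegrable (fun x => cos x ^ m / (1 + cos x)) volume 0 (π / 2) := by
  apply ContinuousOn.intervalIntegrable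
  rw [Set.uIcc_of_le (by positivity)]
  apply ContinuousOn.div (by fun_prop) (by fun_prop)
  intro x hx
  exact (one_add_cos_pos hx).ne'

theorem J_zero : ∫ x in (0 : ℝ)..(π / 2), cos x ^ 0 / (1 + cos x) = 1 := by
  rw [intervalIntegral.integral_eq_sub_of_hasDerivAt (f := fun x => sin x / (1 + cos x)) _ (J_int 0)]
  · simp
  · intro x hx
    rw [Set.uIcc_of_le (by positivity)] at hx
    have h := one_add_cos_pos hx
    have := (hasDerivAt_sin x).div ((hasDerivAt_cos x).const_add 1) h.ne'
    refine this.congr_deriv ?_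
    field_simp
    nlinarith [sin_sq_add_cos_sq x]

theorem J_succ (m : ℕ) : ∫ x in (0 : ℝ)..(π / 2), cos x ^ (m + 1) / (1 + cos x)
    = auxT (m + 1) - ∫ x in (0 : ℝ)..(π / 2), cos x ^ m / (1 + cos x) := by
  rw [eq_sub_iff_add_eq, ← intervalIntegral.integral_add (J_int _) (J_int _), ← cos_int]
  apply intervalIntegral.integral_congr
  intro x hx
  rw [Set.uIcc_of_le (by positivity)] at hx
  have h := one_add_cos_pos hx
  simp only
  field_simp
  ring

theorem J_eq (m : ℕ) : ∫ x in (0 : ℝ)..(π / 2), cos x ^ m / (1 + cos x)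
    = ∑ i ∈ Finset.range (m + 1), (-1 : ℝ) ^ i * auxT (m - i) := by
  induction m with
  | zero => rw [J_zero]; simp [auxT]
  | succ m ih =>
    rw [J_succ, ih, Finset.sum_range_succ' _ (m + 1)]
    have : ∀ i, m + 1 - (i + 1) = m - i := by intro i; omega
    simp only [this, pow_succ, pow_zero, Nat.sub_zero]
    simp only [mul_neg, mul_one, neg_mul, Finset.sum_neg_distrib]
    ring

theorem image_eq (a : ℝ) (ha : 0 < a) :
    (fun x => a / cos x) '' Set.Ioo 0 (π / 2) = Set.Ioi a := by
  ext r
  constructor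
  · rintro ⟨x, hx, rfl⟩
    have hc : 0 < cos x := cos_pos_of_mem_Ioo ⟨by linarith [hx.1, pi_pos], hx.2⟩
    have hc1 : cos x < 1 := by
      rw [← cos_zero]
      exact cos_lt_cos_of_nonneg_of_le_pi_div_two le_rfl hx.2.le hx.1
    simp only [Set.mem_Ioi]
    rw [lt_div_iff₀ hc]
    nlinarith
  · intro hr
    have hr : a < r := hr
    have hr0 : 0 < r := ha.trans hr
    have h1 : a / r < 1 := by rw [div_lt_one hr0]; exact hr
    have h0 : 0 < a / r := by positivity
    refine ⟨arccos (a / r), ⟨arccos_pos.2 h1, arccos_lt_pi_div_two.2 h0⟩, ?_⟩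
    simp only
    rw [cos_arccos (by linarith) h1.le]
    field_simp

theorem change (m : ℕ) (a : ℝ) (ha : 0 < a) :
    (∫ r in Set.Ioi a, 1 / (r ^ m * (r + a) * Real.sqrt (r ^ 2 - a ^ 2)))
      = (a ^ (m + 1))⁻¹ * ∫ x in (0 : ℝ)..(π / 2), cos x ^ m / (1 + cos x) := by
  have hcos : ∀ x ∈ Set.Ioo 0 (π / 2), 0 < cos x := fun x hx =>
    cos_pos_of_mem_Ioo ⟨by linarith [hx.1, pi_pos], hx.2⟩
  rw [← image_eq a ha, integral_image_eq_integral_abs_deriv_smul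
    (f' := fun x => a * sin x / cos x ^ 2) measurableSet_Ioo]
  · rw [intervalIntegral.integral_of_le (by positivity), integral_Ioc_eq_integral_Ioo,
      ← integral_const_mul]
    apply setIntegral_congr_fun measurableSet_Ioo
    intro x hx
    have hc := hcos x hx
    have hs : 0 < sin x := sin_pos_of_pos_of_lt_pi hx.1 (by linarith [hx.2, pi_pos])
    have hsq : Real.sqrt ((a / cos x) ^ 2 - a ^ 2) = a * sin x / cos x := by
      rw [Real.sqrt_eq_iff_mul_self_eq_of_pos (by positivity)]
      field_simp
      nlinarith [sin_sq_add_cos_sq x]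
    simp only [smul_eq_mul]
    rw [hsq, abs_of_pos (by positivity)]
    have h1 : a / cos x + a = a * (1 + cos x) / cos x := by field_simp
    rw [h1, div_pow]
    have h2 : 0 < 1 + cos x := by linarith
    field_simp
    ring
  · intro x hx
    have hc := hcos x hx
    have := (hasDerivAt_const x a).div (hasDerivAt_cos x) hc.ne'
    refine (this.congr_deriv ?_).hasDerivWithinAt
    ring
  · intro x hx y hy hxy
    have hx' := hcos x hx
    have hy' := hcos y hy
    simp only at hxy
    have : cos x = cos y := by
      field_simp at hxy
      linarith
    exact injOn_cos ⟨hx.1.le, by linarith [hx.2, pi_pos]⟩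
      ⟨hy.1.le, by linarith [hy.2, pi_pos]⟩ this

/-- For an integer m ≥ 0 and a > 0,
∫_a^∞ dr/(r^m·(r+a)·√(r² − a²))
  = a^{-(m+1)} · ∑_{i=0}^m (−1)^i·((m−i−2)!!/(m−i−1)!!)·(π/2)^{(1−(−1)^{m−i})/2},
with double factorials of negative integers understood to be 1. -/
theorem stmt_8 (m : ℕ) (a : ℝ) (ha : 0 < a) :
    (∫ r in Set.Ioi a, 1 / (r ^ m * (r + a) * Real.sqrt (r ^ 2 - a ^ 2)))
      = a ^ (-((m : ℝ) + 1)) *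
          ∑ i ∈ Finset.range (m + 1),
            (-1 : ℝ) ^ i
              * ((Nat.doubleFactorial (m - i - 2) : ℝ) / (Nat.doubleFactorial (m - i - 1) : ℝ))
              * (Real.pi / 2) ^ ((1 - (-1 : ℝ) ^ (m - i)) / 2) := by
  rw [change m a ha, J_eq]
  congr 1
  · rw [Real.rpow_neg ha.le]
    congr 1
    exact_mod_cast (Real.rpow_natCast a (m + 1)).symm
  · apply Finset.sum_congr rfl
    intro i _
    rw [auxT, mul_assoc]
end

section
/- Let n ≥ 3 be an integer. Define g : (0,∞) → ℝ by g(z) = n/(1 − z^n) − 2/(1 − z²) for z ≠ 1 and g(1) = (n−2)/2. Then g is continuous on (0,∞), the improper integral ∫_0^∞ g(z) dz converges, and ∫_0^∞ g(z) dz = π·cot(π/n). -/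
open Real MeasureTheory

namespace KruskalAux

open Filter Topology

/-- geometric sum -/
noncomputable def sg (n : ℕ) (z : ℝ) : ℝ := ∑ i ∈ Finset.range n, z ^ i

/-- numerator -/
noncomputable def qn (n : ℕ) (z : ℝ) : ℝ := ∑ i ∈ Finset.range n, (2 * sg i z - 1)

lemma sg_mul (n : ℕ) (z : ℝ) : (1 - z) * sg n z = 1 - z ^ n := mul_neg_geom_sum z n

lemma sg_cont (n : ℕ) : Continuous (sg n) := by unfold sg; fun_prop

lemma qn_cont (n : ℕ) : Continuous (qn n) := by
  unfold qn
  have := sg_cont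
  fun_prop

lemma sg_one (n : ℕ) : sg n 1 = n := by simp [sg]

lemma qn_one (n : ℕ) : qn n 1 = n * (n - 2) := by
  unfold qn
  simp only [sg_one]
  induction n with
  | zero => simp
  | succ k ih => rw [Finset.sum_range_succ, ih]; push_cast; ring

lemma qn_mul (n : ℕ) (z : ℝ) : (1 - z) * qn n z = n * (1 + z) - 2 * sg n z := by
  induction n with
  | zero => simp [qn, sg]
  | succ k ih =>
    have h1 : qn (k+1) z = qn k z + (2 * sg k z - 1) :=
      Finset.sum_range_succ _ _
    have h2 : sg (k+1) z = sg k z + z ^ k := by simp [sg, Finset.sum_range_succ]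
    rw [h1, h2]
    push_cast
    linear_combination ih + 2 * sg_mul k z

lemma sg_pos {n : ℕ} (hn : 0 < n) {z : ℝ} (hz : 0 ≤ z) : 0 < sg n z := by
  obtain ⟨m, rfl⟩ : ∃ m, n = m + 1 := ⟨n - 1, by omega⟩
  unfold sg
  rw [Finset.sum_range_succ']
  have : 0 ≤ ∑ i ∈ Finset.range m, z ^ (i+1) := Finset.sum_nonneg fun i _ => by positivity
  simp only [pow_zero]
  linarith

lemma cot_sum (m : ℕ) (hm : 1 ≤ m) :
    Tendsto (fun N : ℕ => ∑ k ∈ Finset.range N,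
      ((m + 2 : ℝ) * (1 / ((m + 2 : ℝ) * k + 1) - 1 / ((m + 2 : ℝ) * k + m + 1)))) atTop
      (𝓝 (π * Real.cot (π / (m + 2 : ℝ)))) := by
  set a : ℝ := 1 / (m + 2 : ℝ) with ha
  have hm' : (1:ℝ) ≤ m := by exact_mod_cast hm
  have ha0 : 0 < a := by positivity
  have ha1 : a < 1 := by rw [ha, div_lt_one (by positivity)]; linarith
  have hx : (a : ℂ) ∈ Complex.integerComplement := by
    rw [Complex.mem_integerComplement_iff]
    rintro ⟨k, hk⟩
    have hk' : (k : ℝ) = a := by exact_mod_cast hk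
    rw [← hk'] at ha0 ha1
    have h0 : 0 < k := by exact_mod_cast ha0
    have h1 : k < 1 := by exact_mod_cast ha1
    omega
  have h := tendsto_logDeriv_euler_cot_sub hx
  have hr : Tendsto (fun N : ℕ => ∑ k ∈ Finset.range N,
      (1 / (a - (k + 1)) + 1 / (a + (k + 1)))) atTop (𝓝 (π * Real.cot (π * a) - 1 / a)) := by
    have h2 := (Complex.continuous_re.tendsto _).comp h
    have e : ((π : ℂ) * Complex.cot (π * a) - 1 / a).re = π * Real.cot (π * a) - 1 / a := by
      have : ((π : ℂ) * Complex.cot (π * a) - 1 / a)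
        = ((π * Real.cot (π * a) - 1 / a : ℝ) : ℂ) := by push_cast; rfl
      rw [this, Complex.ofReal_re]
    rw [e] at h2
    refine h2.congr fun N => ?_
    have : (∑ j ∈ Finset.range N, cotTerm (a : ℂ) j)
      = ((∑ k ∈ Finset.range N, (1 / (a - (k + 1)) + 1 / (a + (k + 1))) : ℝ) : ℂ) := by
      push_cast; rfl
    simp only [Function.comp]
    rw [this, Complex.ofReal_re]
  have hl : Tendsto (fun N : ℕ => 1 / a - 1 / (a + N)) atTop (𝓝 (1 / a - 0)) := by
    refine tendsto_const_nhds.sub ?_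
    simp only [one_div]
    exact tendsto_inv_atTop_zero.comp
      (tendsto_atTop_add_const_left _ _ tendsto_natCast_atTop_atTop)
  have hs := hr.add hl
  have e1 : π * Real.cot (π * a) - 1 / a + (1 / a - 0) = π * Real.cot (π / (m + 2 : ℝ)) := by
    rw [ha]; ring_nf
  rw [e1] at hs
  refine hs.congr fun N => ?_
  have hterm : ∀ k : ℕ, ((m + 2 : ℝ) * (1 / ((m + 2 : ℝ) * k + 1) - 1 / ((m + 2 : ℝ) * k + m + 1)))
      = 1 / (a + k) + 1 / (a - (k + 1)) := by
    intro k
    have h1 : a + k = ((m + 2 : ℝ) * k + 1) / (m + 2) := by rw [ha]; field_simp; ring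
    have h2 : a - (k + 1) = -(((m + 2 : ℝ) * k + m + 1) / (m + 2)) := by
      rw [ha]; field_simp; ring
    rw [h1, h2]
    have : (m + 2 : ℝ) * k + 1 ≠ 0 := by positivity
    have : (m + 2 : ℝ) * k + m + 1 ≠ 0 := by positivity
    field_simp
    ring
  induction N with
  | zero => simp
  | succ N ih =>
    rw [Finset.sum_range_succ, Finset.sum_range_succ, ← ih, hterm]
    push_cast
    ring

lemma int_pow (j : ℕ) : ∫ w in Set.Ioo (0:ℝ) 1, w ^ j = 1 / ((j : ℝ) + 1) := by
  rw [← integral_Ioc_eq_integral_Ioo, ← intervalIntegral.integral_of_le zero_le_one, integral_pow]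
  simp

lemma int_pow' (j : ℕ) : Integrable (fun w : ℝ => w ^ j) (volume.restrict (Set.Ioo (0:ℝ) 1)) := by
  have : IntegrableOn (fun w : ℝ => w ^ j) (Set.Icc (0:ℝ) 1) :=
    (continuous_pow j).continuousOn.integrableOn_compact isCompact_Icc
  exact this.mono_set Set.Ioo_subset_Icc_self

lemma int_F (m : ℕ) (hm : 1 ≤ m) :
    ∫ w in Set.Ioo (0:ℝ) 1, (m + 2 : ℝ) * sg m w / sg (m + 2) w
      = π * Real.cot (π / (m + 2 : ℝ)) := by
  let F : ℕ → ℝ → ℝ := fun k w => (m + 2 : ℝ) * (w ^ ((m + 2) * k) - w ^ ((m + 2) * k + m))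
  have hint : ∀ k, Integrable (F k) (volume.restrict (Set.Ioo (0:ℝ) 1)) := fun k =>
    ((int_pow' _).sub (int_pow' _)).const_mul _
  have hval : ∀ k, ∫ w in Set.Ioo (0:ℝ) 1, F k w
      = (m + 2 : ℝ) * (1 / ((m + 2 : ℝ) * k + 1) - 1 / ((m + 2 : ℝ) * k + m + 1)) := by
    intro k
    simp only [F]
    rw [integral_const_mul, integral_sub (int_pow' _) (int_pow' _), int_pow, int_pow]
    push_cast
    rfl
  have hnn : ∀ k, ∀ w ∈ Set.Ioo (0:ℝ) 1, 0 ≤ F k w := by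
    intro k w hw
    refine mul_nonneg (by positivity) (sub_nonneg.2 ?_)
    exact pow_le_pow_of_le_one hw.1.le hw.2.le (by omega)
  have hnorm : ∀ k, ∫ w in Set.Ioo (0:ℝ) 1, ‖F k w‖ = ∫ w in Set.Ioo (0:ℝ) 1, F k w := by
    intro k
    refine setIntegral_congr_fun measurableSet_Ioo fun w hw => ?_
    exact Real.norm_of_nonneg (hnn k w hw)
  have hsum : HasSum (fun k => ∫ w in Set.Ioo (0:ℝ) 1, F k w) (π * Real.cot (π / (m + 2 : ℝ))) := by
    rw [hasSum_iff_tendsto_nat_of_nonneg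
      (fun k => setIntegral_nonneg measurableSet_Ioo (hnn k))]
    simp only [hval]
    exact cot_sum m hm
  have key := hasSum_integral_of_summable_integral_norm hint
    (by simp only [hnorm]; exact hsum.summable)
  rw [← key.unique hsum]
  refine setIntegral_congr_fun measurableSet_Ioo fun w hw => ?_
  have hlt : w ^ (m + 2) < 1 := pow_lt_one₀ hw.1.le hw.2 (by omega)
  have hg := (hasSum_geometric_of_lt_one (pow_nonneg hw.1.le (m+2)) hlt).mul_left
    ((m + 2 : ℝ) * (1 - w ^ m))
  have hF : (fun k => F k w) = fun k => (m + 2 : ℝ) * (1 - w ^ m) * (w ^ (m + 2)) ^ k := by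
    funext k
    simp only [F]
    rw [← pow_mul, pow_add]
    ring
  rw [hF, hg.tsum_eq, ← sg_mul, ← sg_mul]
  have h1 : 1 - w ≠ 0 := by linarith [hw.2]
  have h2 := (sg_pos (n := m + 2) (by omega) hw.1.le).ne'
  field_simp

end KruskalAux

open KruskalAux in
/-- For integer n ≥ 3, the function
g(z) = n/(1 − z^n) − 2/(1 − z²) for z ≠ 1, g(1) = (n−2)/2, is continuous on (0,∞),
integrable on (0,∞), and ∫_0^∞ g(z) dz = π·cot(π/n). -/
theorem stmt_9 (n : ℕ) (hn : 3 ≤ n)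
    (g : ℝ → ℝ)
    (hg1 : g 1 = ((n : ℝ) - 2) / 2)
    (hg : ∀ z : ℝ, z ≠ 1 → g z = (n : ℝ) / (1 - z ^ n) - 2 / (1 - z ^ 2)) :
    ContinuousOn g (Set.Ioi (0 : ℝ)) ∧
    IntegrableOn g (Set.Ioi (0 : ℝ)) ∧
    (∫ z in Set.Ioi (0 : ℝ), g z) = Real.pi * Real.cot (Real.pi / n) := by
  obtain ⟨m, rfl⟩ : ∃ m, n = m + 2 := ⟨n - 2, by omega⟩
  have hm : 1 ≤ m := by omega
  have hpos : ∀ z : ℝ, 0 ≤ z → 0 < sg (m + 2) z := fun z hz => sg_pos (by omega) hz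
  have hgG : ∀ z : ℝ, 0 ≤ z → g z = qn (m + 2) z / (sg (m + 2) z * (1 + z)) := by
    intro z hz
    by_cases h : z = 1
    · subst h
      rw [hg1, qn_one, sg_one]
      have : ((m + 2 : ℕ) : ℝ) ≠ 0 := by positivity
      field_simp
      norm_num
      ring
    · have h1 : 1 - z ≠ 0 := sub_ne_zero.2 (Ne.symm h)
      have h2 : 1 + z ≠ 0 := by positivity
      have h3 := (hpos z hz).ne'
      rw [hg z h, ← sg_mul, show 1 - z ^ 2 = (1 - z) * (1 + z) by ring]
      have := qn_mul (m + 2) z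
      field_simp
      linear_combination -this
  have hcont : ContinuousOn g (Set.Ici (0 : ℝ)) := by
    refine ContinuousOn.congr ?_ (fun z hz => hgG z hz)
    refine ContinuousOn.div (qn_cont _).continuousOn
      (((sg_cont _).mul (by fun_prop)).continuousOn) fun z hz => ?_
    have : (0:ℝ) ≤ z := hz
    exact (mul_pos (hpos z hz) (by positivity)).ne'
  have hgI : IntegrableOn g (Set.Icc (0:ℝ) 1) :=
    (hcont.mono Set.Icc_subset_Ici_self).integrableOn_compact isCompact_Icc
  have hgI' : IntegrableOn g (Set.Ioo (0:ℝ) 1) := hgI.mono_set Set.Ioo_subset_Icc_self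
  have hFI : IntegrableOn (fun w => (m + 2 : ℝ) * sg m w / sg (m + 2) w) (Set.Ioo (0:ℝ) 1) := by
    have : IntegrableOn (fun w => (m + 2 : ℝ) * sg m w / sg (m + 2) w) (Set.Icc (0:ℝ) 1) := by
      refine ContinuousOn.integrableOn_compact isCompact_Icc ?_
      exact ContinuousOn.div (continuous_const.mul (sg_cont _)).continuousOn
        (sg_cont _).continuousOn fun z hz => (hpos z hz.1).ne'
    exact this.mono_set Set.Ioo_subset_Icc_self
  have himg : (fun x : ℝ => x⁻¹) '' Set.Ioo (0:ℝ) 1 = Set.Ioi 1 := by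
    ext y
    constructor
    · rintro ⟨x, hx, rfl⟩
      exact (one_lt_inv₀ hx.1).2 hx.2
    · intro hy
      have hy' : (1:ℝ) < y := hy
      exact ⟨y⁻¹, ⟨by positivity, inv_lt_one_of_one_lt₀ hy'⟩, inv_inv y⟩
  have hder : ∀ x ∈ Set.Ioo (0:ℝ) 1,
      HasDerivWithinAt (fun x : ℝ => x⁻¹) (-(x ^ 2)⁻¹) (Set.Ioo (0:ℝ) 1) x := fun x hx =>
    (hasDerivAt_inv hx.1.ne').hasDerivWithinAt
  have hinj : Set.InjOn (fun x : ℝ => x⁻¹) (Set.Ioo (0:ℝ) 1) := inv_injective.injOn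
  have heq : Set.EqOn (fun x : ℝ => |-(x ^ 2)⁻¹| • g x⁻¹)
      (fun w => (m + 2 : ℝ) * sg m w / sg (m + 2) w - g w) (Set.Ioo (0:ℝ) 1) := by
    intro w hw
    have hw0 : w ≠ 0 := hw.1.ne'
    have h1 : 1 - w ≠ 0 := by linarith [hw.2]
    have h2 := (hpos w hw.1.le).ne'
    have hwp : 0 < w := hw.1
    have h3 : 1 + w ≠ 0 := by positivity
    have hne : w⁻¹ ≠ 1 := by
      intro h; rw [inv_eq_one] at h; exact hw.2.ne h
    have e1 : (m + 2 : ℝ) * sg m w / sg (m + 2) w = (m + 2 : ℝ) * (1 - w ^ m) / (1 - w ^ (m+2)) := by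
      rw [← sg_mul, ← sg_mul]; field_simp
    have hd1 : 1 - w ^ (m + 2) ≠ 0 := by rw [← sg_mul]; exact mul_ne_zero h1 h2
    have hd2 : 1 - w ^ 2 ≠ 0 := by
      rw [show 1 - w ^ 2 = (1 - w) * (1 + w) by ring]; exact mul_ne_zero h1 h3
    have e2 : 1 - (w⁻¹) ^ (m + 2) = -(1 - w ^ (m + 2)) / w ^ (m + 2) := by
      rw [inv_pow]; field_simp; ring
    have e3 : 1 - (w⁻¹) ^ 2 = -(1 - w ^ 2) / w ^ 2 := by
      rw [inv_pow]; field_simp; ring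
    simp only [smul_eq_mul, abs_neg]
    rw [abs_of_pos (by positivity), e1, hg _ hne, hg w hw.2.ne, e2, e3]
    push_cast
    generalize hA : 1 - w ^ (m + 2) = A at *
    generalize hB : 1 - w ^ 2 = B at *
    rw [pow_add]
    field_simp
    ring
  have hI1 : IntegrableOn g (Set.Ioi (1:ℝ)) := by
    rw [← himg, integrableOn_image_iff_integrableOn_abs_deriv_smul measurableSet_Ioo hder hinj,
      integrableOn_congr_fun heq measurableSet_Ioo]
    exact hFI.sub hgI'
  have hv1 : ∫ z in Set.Ioi (1:ℝ), g z
      = π * Real.cot (π / (m + 2 : ℝ)) - ∫ z in Set.Ioo (0:ℝ) 1, g z := by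
    rw [← himg, integral_image_eq_integral_abs_deriv_smul measurableSet_Ioo hder hinj,
      setIntegral_congr_fun measurableSet_Ioo heq, integral_sub hFI hgI', int_F m hm]
  have hI0 : IntegrableOn g (Set.Ioc (0:ℝ) 1) := hgI.mono_set Set.Ioc_subset_Icc_self
  have hU : Set.Ioi (0:ℝ) = Set.Ioc 0 1 ∪ Set.Ioi 1 := (Set.Ioc_union_Ioi_eq_Ioi zero_le_one).symm
  refine ⟨hcont.mono Set.Ioi_subset_Ici_self, ?_, ?_⟩
  · rw [hU]; exact hI0.union hI1
  · rw [hU, setIntegral_union Set.Ioc_disjoint_Ioi_same measurableSet_Ioi hI0 hI1, hv1,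
      integral_Ioc_eq_integral_Ioo]
    push_cast
    ring
end

section
/- Let d ≥ 4 be an integer, ℓ > 0, λ > 0, and fix T, T' ∈ ℝ, φ, φ' ∈ ℝ, and unit vectors x̂, x̂' ∈ ℝ^{d−2}. Set Z = cosh T·cosh T'·(x̂·x̂') − sinh T·sinh T' and assume cosh(λ(φ−φ')) − Z > 0. For ρ > 1 let D(ρ) = 2ℓ²·(−1 + ρ²·[cosh(λ(φ−φ')) − (1 − ρ^{-2})·Z]) and, for ρ large enough that D(ρ) > 0, let L(ρ) = 2ℓ·arsinh(√(D(ρ))/(2ℓ)). Then lim_{ρ→∞} ρ^{d−3}·exp(−(d−3)·L(ρ)/(2ℓ)) = [2·(cosh(λ(φ−φ')) − Z)]^{-(d−3)/2}. -/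
open Real Filter Topology

/-- With Z = cosh T·cosh T'·(x̂·x̂') − sinh T·sinh T', assuming
cosh(λ(φ−φ')) − Z > 0, D(ρ) = 2ℓ²·(−1 + ρ²·[cosh(λ(φ−φ')) − (1−ρ^{-2})·Z]) and
L(ρ) = 2ℓ·arsinh(√(D(ρ))/(2ℓ)), we have
lim_{ρ→∞} ρ^{d−3}·exp(−(d−3)·L(ρ)/(2ℓ)) = [2·(cosh(λ(φ−φ')) − Z)]^{-(d−3)/2}. -/
theorem stmt_12 (d : ℕ) (hd : 4 ≤ d) (ℓ lam : ℝ) (hℓ : 0 < ℓ) (hlam : 0 < lam)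
    (T T' φ φ' : ℝ) (x x' : Fin (d - 2) → ℝ)
    (hx : ∑ i, (x i) ^ 2 = 1) (hx' : ∑ i, (x' i) ^ 2 = 1)
    (Z : ℝ)
    (hZ : Z = Real.cosh T * Real.cosh T' * (∑ i, x i * x' i)
            - Real.sinh T * Real.sinh T')
    (hpos : 0 < Real.cosh (lam * (φ - φ')) - Z) :
    Tendsto (fun ρ : ℝ =>
        ρ ^ (d - 3) *
          Real.exp (-((d : ℝ) - 3) *
            (2 * ℓ * Real.arsinh (Real.sqrt
              (2 * ℓ ^ 2 * (-1 + ρ ^ 2 * (Real.cosh (lam * (φ - φ'))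
                  - (1 - ρ ^ (-2 : ℤ)) * Z))) / (2 * ℓ))) / (2 * ℓ)))
      atTop
      (nhds ((2 * (Real.cosh (lam * (φ - φ')) - Z)) ^ (-(((d : ℝ) - 3) / 2)))) := by
  have hn : ((d - 3 : ℕ) : ℝ) = (d : ℝ) - 3 := by
    rw [Nat.cast_sub (by omega)]; norm_num
  rw [← hn]
  generalize d - 3 = n
  clear hn
  generalize Real.cosh (lam * (φ - φ')) = C at *
  have hinv : Tendsto (fun ρ : ℝ => ρ⁻¹) atTop (nhds 0) := tendsto_inv_atTop_zero
  have hv : Tendsto (fun ρ : ℝ => Real.sqrt (((Z - 1) * (ρ⁻¹) ^ 2 + (C - Z)) / 2)) atTop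
      (nhds (Real.sqrt ((C - Z) / 2))) := by
    have h := ((((hinv.pow 2).const_mul (Z - 1)).add_const (C - Z)).div_const 2).sqrt
    simpa using h
  have hs0 : 0 < Real.sqrt ((C - Z) / 2) := Real.sqrt_pos.2 (by linarith)
  have hw := (hv.add ((hinv.pow 2).add (hv.pow 2)).sqrt)
  have hlim : Real.sqrt ((C - Z) / 2) + Real.sqrt (0 ^ 2 + Real.sqrt ((C - Z) / 2) ^ 2)
      = Real.sqrt (2 * (C - Z)) := by
    have h1 : Real.sqrt (0 ^ 2 + Real.sqrt ((C - Z) / 2) ^ 2) = Real.sqrt ((C - Z) / 2) := by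
      rw [zero_pow two_ne_zero, zero_add, Real.sqrt_sq hs0.le]
    have h2 : 2 * (C - Z) = 2 ^ 2 * ((C - Z) / 2) := by ring
    rw [h1, h2, Real.sqrt_mul (by norm_num), Real.sqrt_sq (by norm_num)]
    ring
  rw [hlim] at hw
  have hs1 : 0 < Real.sqrt (2 * (C - Z)) := Real.sqrt_pos.2 (by linarith)
  have hf := (hw.inv₀ hs1.ne').pow n
  have hR : (2 * (C - Z)) ^ (-((n : ℝ) / 2)) = (Real.sqrt (2 * (C - Z)))⁻¹ ^ n := by
    have h0 : 0 ≤ 2 * (C - Z) := by linarith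
    rw [Real.rpow_neg h0, inv_pow, ← Real.rpow_natCast (Real.sqrt _), Real.sqrt_eq_rpow,
      ← Real.rpow_mul h0]
    congr 2
    ring
  rw [hR]
  refine hf.congr' ?_
  filter_upwards [eventually_gt_atTop 0] with ρ hρ
  set v := Real.sqrt (((Z - 1) * (ρ⁻¹) ^ 2 + (C - Z)) / 2) with hvdef
  have hu : Real.sqrt (2 * ℓ ^ 2 * (-1 + ρ ^ 2 * (C - (1 - ρ ^ (-2 : ℤ)) * Z))) / (2 * ℓ)
      = ρ * v := by
    have h1 : 2 * ℓ ^ 2 * (-1 + ρ ^ 2 * (C - (1 - ρ ^ (-2 : ℤ)) * Z))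
        = (2 * ℓ * ρ) ^ 2 * (((Z - 1) * (ρ⁻¹) ^ 2 + (C - Z)) / 2) := by
      rw [zpow_neg, show (2 : ℤ) = ((2 : ℕ) : ℤ) from rfl, zpow_natCast]
      field_simp
      ring
    rw [h1, Real.sqrt_mul (sq_nonneg _), Real.sqrt_sq (by positivity), ← hvdef]
    field_simp
  rw [hu]
  have he : -(n : ℝ) * (2 * ℓ * Real.arsinh (ρ * v)) / (2 * ℓ)
      = n * (-Real.arsinh (ρ * v)) := by
    field_simp
  have hq : Real.sqrt (1 + (ρ * v) ^ 2) = ρ * Real.sqrt (ρ⁻¹ ^ 2 + v ^ 2) := by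
    have h1 : 1 + (ρ * v) ^ 2 = ρ ^ 2 * (ρ⁻¹ ^ 2 + v ^ 2) := by
      field_simp
    rw [h1, Real.sqrt_mul (sq_nonneg _), Real.sqrt_sq hρ.le]
  rw [he, Real.exp_nat_mul, ← mul_pow, Real.exp_neg, Real.exp_arsinh, hq, ← mul_add, mul_inv,
    mul_inv_cancel_left₀ hρ.ne']
end

section
/- Let d ≥ 4 be an integer. For λ > 0 define Σ(λ) = ∑_{k=1}^∞ [(d−3)·cosh(2πkλ) + (d−1)] / cosh(2πkλ)^{(d−1)/2}. Then Σ(λ) is asymptotic to (d−3)·2^{(d−3)/2}·e^{-(d−3)πλ} as λ → ∞; that is, Σ(λ)·e^{(d−3)πλ} / ((d−3)·2^{(d−3)/2}) → 1 as λ → ∞. -/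
open Real Filter Topology

lemma aux_term (a lam k c x : ℝ) (hx : x = 2 * Real.pi * (k + 1) * lam) (hc : 0 < c) :
    (a * c + (a + 2)) / c ^ ((a + 2) / 2) * Real.exp (a * Real.pi * lam)
      = (a + (a + 2) / c) * (c * Real.exp (-x)) ^ (-(a / 2)) * Real.exp (-(a * Real.pi * k * lam)) := by
  have h1 : c ^ ((a + 2) / 2) = c ^ (a / 2) * c := by
    rw [show (a + 2) / 2 = a / 2 + 1 by ring, Real.rpow_add hc, Real.rpow_one]
  have h2 : (c * Real.exp (-x)) ^ (-(a / 2)) = (c ^ (a / 2))⁻¹ * Real.exp (x * a / 2) := by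
    rw [Real.mul_rpow hc.le (Real.exp_pos _).le, Real.rpow_neg hc.le, ← Real.exp_mul]
    congr 2; ring
  have h3 : Real.exp (a * Real.pi * lam)
      = Real.exp (x * a / 2) * Real.exp (-(a * Real.pi * k * lam)) := by
    rw [← Real.exp_add, hx]; congr 1; ring
  rw [h1, h2, h3]
  have := Real.rpow_pos_of_pos hc (a / 2)
  field_simp

lemma aux_cosh (x : ℝ) : Real.cosh x * Real.exp (-x) = (1 + Real.exp (-(2 * x))) / 2 := by
  rw [Real.cosh_eq, show -(2 * x) = -x + -x by ring, Real.exp_add]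
  have : Real.exp x * Real.exp (-x) = 1 := by rw [← Real.exp_add]; simp
  linear_combination this / 2

lemma aux_main (a : ℝ) (ha : 0 < a) :
    Tendsto (fun lam : ℝ => ∑' k : ℕ,
      (a * Real.cosh (2 * Real.pi * ((k : ℝ) + 1) * lam) + (a + 2))
        / Real.cosh (2 * Real.pi * ((k : ℝ) + 1) * lam) ^ ((a + 2) / 2)
        * Real.exp (a * Real.pi * lam)) atTop
      (𝓝 (∑' k : ℕ, if k = 0 then a * 2 ^ (a / 2) else 0)) := by
  have hpi := Real.pi_pos
  have hhalf : ((1 : ℝ) / 2) ^ (-(a / 2)) = 2 ^ (a / 2) := by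
    rw [Real.rpow_neg (by norm_num), one_div, Real.inv_rpow (by norm_num), inv_inv]
  refine tendsto_tsum_of_dominated_convergence
    (bound := fun k : ℕ => (2 * a + 2) * 2 ^ (a / 2) * Real.exp (-(a * Real.pi)) ^ k) ?_ ?_ ?_
  · apply Summable.mul_left
    apply summable_geometric_of_lt_one (Real.exp_pos _).le
    rw [Real.exp_lt_one_iff]
    have := mul_pos ha hpi
    linarith
  · intro k
    have hk : (0 : ℝ) < 2 * Real.pi * ((k : ℝ) + 1) := by positivity
    have hx : Tendsto (fun lam : ℝ => 2 * Real.pi * ((k : ℝ) + 1) * lam) atTop atTop :=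
      tendsto_id.const_mul_atTop hk
    have hc : Tendsto (fun lam : ℝ => Real.cosh (2 * Real.pi * ((k : ℝ) + 1) * lam)) atTop atTop := by
      refine tendsto_atTop_mono (fun lam => ?_) (((Real.tendsto_exp_atTop).comp hx).atTop_div_const
        (show (0 : ℝ) < 2 by norm_num))
      simp only [Function.comp]
      rw [Real.cosh_eq]
      have := Real.exp_pos (-(2 * Real.pi * ((k : ℝ) + 1) * lam))
      linarith
    have t1 : Tendsto (fun lam : ℝ => a + (a + 2) / Real.cosh (2 * Real.pi * ((k : ℝ) + 1) * lam))
        atTop (𝓝 (a + 0)) := tendsto_const_nhds.add (hc.const_div_atTop _)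
    have t2 : Tendsto (fun lam : ℝ => (Real.cosh (2 * Real.pi * ((k : ℝ) + 1) * lam)
        * Real.exp (-(2 * Real.pi * ((k : ℝ) + 1) * lam))) ^ (-(a / 2)))
        atTop (𝓝 (((1 : ℝ) / 2) ^ (-(a / 2)))) := by
      refine Tendsto.rpow_const ?_ (Or.inl (by norm_num))
      simp only [aux_cosh]
      have := Real.tendsto_exp_neg_atTop_nhds_zero.comp (hx.const_mul_atTop (show (0 : ℝ) < 2 by norm_num))
      have := ((tendsto_const_nhds (x := (1 : ℝ))).add this).div_const 2
      simpa using this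
    have t3 : Tendsto (fun lam : ℝ => Real.exp (-(a * Real.pi * k * lam))) atTop
        (𝓝 (if k = 0 then 1 else 0)) := by
      by_cases h : k = 0
      · simp [h]
      · rw [if_neg h]
        have hk' : (0 : ℝ) < k := by exact_mod_cast Nat.pos_of_ne_zero h
        exact Real.tendsto_exp_neg_atTop_nhds_zero.comp
          (tendsto_id.const_mul_atTop (show 0 < a * Real.pi * k by positivity))
    have t := (t1.mul t2).mul t3
    rw [hhalf] at t
    convert t using 1
    · ext lam
      exact aux_term a lam k _ _ rfl (Real.cosh_pos _)
    · split_ifs <;> simp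
  · filter_upwards [eventually_ge_atTop 1] with lam hlam k
    rw [aux_term a lam k _ _ rfl (Real.cosh_pos _)]
    set x := 2 * Real.pi * ((k : ℝ) + 1) * lam
    have hc1 := Real.one_le_cosh x
    have hcp := Real.cosh_pos x
    rw [Real.norm_of_nonneg (by positivity), ← Real.exp_nat_mul, ← hhalf]
    have b1 : a + (a + 2) / Real.cosh x ≤ 2 * a + 2 := by
      have : (a + 2) / Real.cosh x ≤ a + 2 := div_le_self (by linarith) hc1
      linarith
    have b2 : (Real.cosh x * Real.exp (-x)) ^ (-(a / 2)) ≤ ((1 : ℝ) / 2) ^ (-(a / 2)) := by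
      apply Real.rpow_le_rpow_of_nonpos (by norm_num) _ (by linarith)
      rw [aux_cosh]
      have := Real.exp_pos (-(2 * x))
      linarith
    have b3 : Real.exp (-(a * Real.pi * k * lam)) ≤ Real.exp (k * -(a * Real.pi)) := by
      apply Real.exp_le_exp.2
      have : 0 ≤ a * Real.pi * k := by positivity
      nlinarith
    gcongr

/-- For d ≥ 4 and
Σ(λ) = ∑_{k=1}^∞ [(d−3)·cosh(2πkλ) + (d−1)]/cosh(2πkλ)^{(d−1)/2},
Σ(λ) ∼ (d−3)·2^{(d−3)/2}·e^{-(d−3)πλ} as λ → ∞. -/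
theorem stmt_13 (d : ℕ) (hd : 4 ≤ d) :
    Tendsto (fun lam : ℝ =>
        (∑' k : ℕ,
            (((d : ℝ) - 3) * Real.cosh (2 * Real.pi * ((k : ℝ) + 1) * lam) + ((d : ℝ) - 1))
              / Real.cosh (2 * Real.pi * ((k : ℝ) + 1) * lam) ^ (((d : ℝ) - 1) / 2))
          * Real.exp (((d : ℝ) - 3) * Real.pi * lam)
          / (((d : ℝ) - 3) * (2 : ℝ) ^ (((d : ℝ) - 3) / 2)))
      atTop (nhds 1) := by
  have hd' : (4 : ℝ) ≤ d := by exact_mod_cast hd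
  obtain ⟨a, ha⟩ : ∃ a : ℝ, a = (d : ℝ) - 3 := ⟨_, rfl⟩
  have ha0 : 0 < a := by linarith
  have h1 : (d : ℝ) - 1 = a + 2 := by linarith
  rw [h1, ← ha]
  have h := (aux_main a ha0).div_const (a * (2 : ℝ) ^ (a / 2))
  simp only [tsum_mul_right, tsum_ite_eq] at h
  rwa [div_self (by positivity)] at h
end

section
/- Let d ≥ 4 be an integer and Z < 1 a fixed real number. For λ > 0 define C_k(λ) = cosh((2k+1)πλ) for k ∈ ℤ, and Σ_g(λ) = ∑_{k∈ℤ} (C_k(λ) + 1) / (C_k(λ) − Z)^{(d−1)/2}. Then Σ_g(λ) is asymptotic to 2^{(d−1)/2}·e^{-(d−3)πλ/2} as λ → ∞; that is, Σ_g(λ)·e^{(d−3)πλ/2} / 2^{(d−1)/2} → 1 as λ → ∞. -/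
open Real Filter Topology

lemma aux_bound_s14 (p Z x : ℝ) (hp : 0 ≤ p) (hZ : Z < 1) (hx : Real.pi ≤ x) :
    0 ≤ (Real.cosh x + 1) / (Real.cosh x - Z) ^ p ∧
    (Real.cosh x + 1) / (Real.cosh x - Z) ^ p ≤ 2 * 4 ^ p * Real.exp (-(p - 1) * x) := by
  have h4 : 4 ≤ Real.exp x := by
    have := Real.add_one_le_exp x
    have := Real.pi_gt_three
    linarith
  have hpos := Real.exp_pos x
  have hneg := Real.exp_pos (-x)
  have hneg1 : Real.exp (-x) ≤ 1 := by
    apply Real.exp_le_one_iff.2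
    have := Real.pi_gt_three
    linarith
  have hlow : Real.exp x / 4 ≤ Real.cosh x - Z := by
    rw [Real.cosh_eq]; linarith
  have hup : Real.cosh x + 1 ≤ 2 * Real.exp x := by
    rw [Real.cosh_eq]; linarith
  have hc := Real.cosh_pos x
  constructor
  · have : 0 ≤ Real.cosh x - Z := by linarith
    positivity
  · calc (Real.cosh x + 1) / (Real.cosh x - Z) ^ p
        ≤ (2 * Real.exp x) / (Real.exp x / 4) ^ p := by
          gcongr
      _ = 2 * 4 ^ p * Real.exp (-(p - 1) * x) := by
          rw [Real.div_rpow hpos.le (by norm_num), ← Real.exp_mul]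
          have : Real.exp (-(p - 1) * x) = Real.exp x / Real.exp (x * p) := by
            rw [← Real.exp_sub]; congr 1; ring
          rw [this]
          field_simp

lemma aux_main_s14 (p Z : ℝ) :
    Tendsto (fun y : ℝ => (Real.cosh y + 1) / (Real.cosh y - Z) ^ p * Real.exp ((p - 1) * y))
      atTop (nhds (2 ^ p / 2)) := by
  have he : Tendsto (fun y : ℝ => Real.exp (-y)) atTop (nhds 0) :=
    Real.tendsto_exp_neg_atTop_nhds_zero
  have hA : ∀ c : ℝ, Tendsto (fun y : ℝ => (Real.cosh y + c) * Real.exp (-y)) atTop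
      (nhds (1 / 2)) := by
    intro c
    have h : Tendsto (fun y : ℝ => 1 / 2 + Real.exp (-y) * Real.exp (-y) / 2 + c * Real.exp (-y))
        atTop (nhds (1 / 2 + 0 * 0 / 2 + c * 0)) :=
      (((he.mul he).div_const 2).const_add _).add (he.const_mul c)
    have e0 : (1 / 2 + 0 * 0 / 2 + c * 0 : ℝ) = 1 / 2 := by ring
    rw [e0] at h
    refine h.congr fun y => ?_
    have : Real.exp y * Real.exp (-y) = 1 := by rw [← Real.exp_add]; simp
    rw [Real.cosh_eq]
    linear_combination -this / 2
  have hB := (hA 1).div ((hA (-Z)).rpow_const (p := p) (Or.inl (by norm_num)))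
    (by positivity)
  have e1 : (1 / 2 : ℝ) / (1 / 2) ^ p = 2 ^ p / 2 := by
    rw [Real.div_rpow (by norm_num) (by norm_num), Real.one_rpow]
    field_simp
  rw [e1] at hB
  refine hB.congr' ?_
  filter_upwards [(hA (-Z)).eventually (lt_mem_nhds (show (0 : ℝ) < 1 / 2 by norm_num))] with y hy
  have hpos : 0 < Real.cosh y + -Z := (pos_iff_pos_of_mul_pos hy).2 (Real.exp_pos _)
  simp only [Pi.div_apply]
  rw [Real.mul_rpow hpos.le (Real.exp_pos _).le, ← Real.exp_mul, ← sub_eq_add_neg]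
  have : Real.exp ((p - 1) * y) = Real.exp (-y) / Real.exp (-y * p) := by
    rw [← Real.exp_sub]; congr 1; ring
  rw [this]
  have := Real.rpow_pos_of_pos hpos p
  rw [← sub_eq_add_neg] at this
  field_simp

lemma aux_abs (k : ℤ) : 1 ≤ |2 * (k : ℝ) + 1| ∧ (k.natAbs : ℝ) ≤ |2 * (k : ℝ) + 1| ∧
    (k ≠ 0 → k ≠ -1 → 2 ≤ |2 * (k : ℝ) + 1|) := by
  have e : |2 * (k : ℝ) + 1| = ((|2 * k + 1| : ℤ) : ℝ) := by push_cast; rfl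
  rw [e]
  refine ⟨?_, ?_, ?_⟩
  · have : (1 : ℤ) ≤ |2 * k + 1| := by grind
    exact_mod_cast this
  · have : (k.natAbs : ℤ) ≤ |2 * k + 1| := by grind
    have h2 : (((k.natAbs : ℕ) : ℤ) : ℝ) ≤ ((|2 * k + 1| : ℤ) : ℝ) := Int.cast_le.2 this
    rwa [Int.cast_natCast] at h2
  · intro h0 h1
    have : (2 : ℤ) ≤ |2 * k + 1| := by grind
    exact_mod_cast this

lemma aux_term_s14 (p Z : ℝ) (hp : 1 < p) (hZ : Z < 1) (k : ℤ) (lam : ℝ) (hl : 1 ≤ lam) :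
    ‖(Real.cosh ((2 * (k : ℝ) + 1) * Real.pi * lam) + 1)
      / (Real.cosh ((2 * (k : ℝ) + 1) * Real.pi * lam) - Z) ^ p
        * Real.exp ((p - 1) * (Real.pi * lam))‖
      ≤ 2 * 4 ^ p * Real.exp (-((p - 1) * Real.pi * (|2 * (k : ℝ) + 1| - 1)) * lam) := by
  have hpi := Real.pi_pos
  have ha := (aux_abs k).1
  have hc : Real.cosh ((2 * (k : ℝ) + 1) * Real.pi * lam)
      = Real.cosh (|2 * (k : ℝ) + 1| * Real.pi * lam) := by
    rw [← Real.cosh_abs, abs_mul, abs_mul, abs_of_pos hpi, abs_of_pos (by linarith : 0 < lam)]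
  rw [hc]
  have hx : Real.pi ≤ |2 * (k : ℝ) + 1| * Real.pi * lam := by
    have : 1 ≤ |2 * (k : ℝ) + 1| * lam := one_le_mul_of_one_le_of_one_le ha hl
    nlinarith
  obtain ⟨h0, h1⟩ := aux_bound_s14 p Z _ (by linarith) hZ hx
  rw [Real.norm_of_nonneg (mul_nonneg h0 (Real.exp_pos _).le)]
  refine (mul_le_mul_of_nonneg_right h1 (Real.exp_pos _).le).trans (le_of_eq ?_)
  rw [mul_assoc, ← Real.exp_add]
  congr 2
  ring

lemma aux_sum (p Z : ℝ) (hp : 1 < p) (hZ : Z < 1) :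
    Tendsto (fun lam : ℝ => ∑' k : ℤ,
      (Real.cosh ((2 * (k : ℝ) + 1) * Real.pi * lam) + 1)
      / (Real.cosh ((2 * (k : ℝ) + 1) * Real.pi * lam) - Z) ^ p
        * Real.exp ((p - 1) * (Real.pi * lam))) atTop (nhds (2 ^ p)) := by
  have hpi := Real.pi_pos
  have hq : 0 < (p - 1) * Real.pi := mul_pos (by linarith) hpi
  have hg : ∑' k : ℤ, (if k = 0 ∨ k = -1 then (2 : ℝ) ^ p / 2 else 0) = 2 ^ p := by
    rw [tsum_eq_sum (s := {0, -1})]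
    · simp
    · intro b hb
      simp at hb
      simp [hb]
  rw [← hg]
  apply tendsto_tsum_of_dominated_convergence
    (bound := fun k : ℤ => 2 * 4 ^ p * Real.exp ((p - 1) * Real.pi)
      * Real.exp (-((p - 1) * Real.pi)) ^ k.natAbs)
  · apply Summable.mul_left
    have hs := summable_geometric_of_lt_one (Real.exp_pos (-((p - 1) * Real.pi))).le
      ((Real.exp_lt_exp.2 (neg_lt_zero.2 hq)).trans_eq Real.exp_zero)
    apply Summable.of_nat_of_neg
    · simpa using hs
    · simpa using hs
  · intro k
    have hlim : Tendsto (fun lam : ℝ => Real.pi * lam) atTop atTop :=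
      tendsto_id.const_mul_atTop hpi
    by_cases h0 : k = 0
    · subst h0
      simpa [Function.comp_def] using (aux_main_s14 p Z).comp hlim
    by_cases h1 : k = -1
    · subst h1
      have := (aux_main_s14 p Z).comp hlim
      simp only [or_true, if_true]
      refine this.congr fun l => ?_
      have : (2 * ((-1 : ℤ) : ℝ) + 1) * Real.pi * l = -(Real.pi * l) := by push_cast; ring
      rw [this, Real.cosh_neg]
      rfl
    · simp only [h0, h1, or_self, if_false]
      have ha := (aux_abs k).2.2 h0 h1
      have hr : 0 < (p - 1) * Real.pi * (|2 * (k : ℝ) + 1| - 1) := mul_pos hq (by linarith)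
      have ht : Tendsto (fun lam : ℝ => 2 * 4 ^ p *
          Real.exp (-((p - 1) * Real.pi * (|2 * (k : ℝ) + 1| - 1)) * lam)) atTop (nhds 0) := by
        have : Tendsto (fun lam : ℝ => 2 * 4 ^ p *
          Real.exp (-((p - 1) * Real.pi * (|2 * (k : ℝ) + 1| - 1)) * lam)) atTop
            (nhds (2 * 4 ^ p * 0)) := by
          refine Tendsto.const_mul _ (Real.tendsto_exp_atBot.comp ?_)
          exact tendsto_id.const_mul_atTop_of_neg (by linarith)
        simpa using this
      refine squeeze_zero_norm' ?_ ht
      filter_upwards [eventually_ge_atTop 1] with l hl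
      exact aux_term_s14 p Z hp hZ k l hl
  · filter_upwards [eventually_ge_atTop 1] with l hl k
    refine (aux_term_s14 p Z hp hZ k l hl).trans ?_
    rw [mul_assoc (2 * 4 ^ p : ℝ), ← Real.exp_nat_mul, ← Real.exp_add]
    gcongr
    obtain ⟨ha, hb, -⟩ := aux_abs k
    have h1 : (|2 * (k : ℝ) + 1| - 1) ≤ (|2 * (k : ℝ) + 1| - 1) * l :=
      le_mul_of_one_le_right (by linarith) hl
    nlinarith

/-- For d ≥ 4, Z < 1, C_k(λ) = cosh((2k+1)πλ) and
Σ_g(λ) = ∑_{k∈ℤ} (C_k(λ)+1)/(C_k(λ) − Z)^{(d−1)/2},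
Σ_g(λ) ∼ 2^{(d−1)/2}·e^{-(d−3)πλ/2} as λ → ∞. -/
theorem stmt_14 (d : ℕ) (hd : 4 ≤ d) (Z : ℝ) (hZ : Z < 1) :
    Tendsto (fun lam : ℝ =>
        (∑' k : ℤ,
            (Real.cosh ((2 * (k : ℝ) + 1) * Real.pi * lam) + 1)
              / (Real.cosh ((2 * (k : ℝ) + 1) * Real.pi * lam) - Z) ^ (((d : ℝ) - 1) / 2))
          * Real.exp (((d : ℝ) - 3) * Real.pi * lam / 2)
          / (2 : ℝ) ^ (((d : ℝ) - 1) / 2))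
      atTop (nhds 1) := by
  have hd' : (4 : ℝ) ≤ d := by exact_mod_cast hd
  have h := (aux_sum (((d : ℝ) - 1) / 2) Z (by linarith) hZ).div_const
    ((2 : ℝ) ^ (((d : ℝ) - 1) / 2))
  rw [div_self (by positivity)] at h
  refine h.congr fun l => ?_
  rw [tsum_mul_right]
  congr 3
  ring
end

section
/- Let d ≥ 4 be an integer. For s > 1 define Δx(s) = 2s·∫_s^∞ r^{(d−5)/2} dr / √((r² − s²)·(r^{d−1} − 1)). Then the integral converges for every s > 1, and Δx(s) / (−ln(s − 1)) → √(2/(d−1)) as s → 1⁺. -/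
open Real Filter Topology MeasureTheory

lemma aux_dom (s : ℝ) (hs : 1 < s) :
    IntegrableOn (fun r : ℝ => 1 / (r ^ 2 * Real.sqrt (r ^ 2 - s ^ 2))) (Set.Ioi s) ∧
    ∫ r in Set.Ioi s, 1 / (r ^ 2 * Real.sqrt (r ^ 2 - s ^ 2)) = 1 / s ^ 2 := by
  have hc : ContinuousWithinAt (fun r : ℝ => Real.sqrt (r ^ 2 - s ^ 2) / (s ^ 2 * r))
      (Set.Ici s) s := by
    apply ContinuousAt.continuousWithinAt
    apply ContinuousAt.div
    · fun_prop
    · fun_prop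
    · positivity
  have hd : ∀ r ∈ Set.Ioi s, HasDerivAt (fun r : ℝ => Real.sqrt (r ^ 2 - s ^ 2) / (s ^ 2 * r))
      (1 / (r ^ 2 * Real.sqrt (r ^ 2 - s ^ 2))) r := by
    intro r hr
    have hr' : s < r := hr
    have h0 : 0 < r ^ 2 - s ^ 2 := by nlinarith
    have hr0 : 0 < r := by linarith
    have h1 : HasDerivAt (fun r : ℝ => r ^ 2 - s ^ 2) (2 * r) r := by
      simpa using (hasDerivAt_pow 2 r).sub_const (s ^ 2)
    have h2 := h1.sqrt h0.ne'
    have h3 : HasDerivAt (fun r : ℝ => s ^ 2 * r) (s ^ 2) r := by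
      simpa using (hasDerivAt_id r).const_mul (s ^ 2)
    have h4 := h2.div h3 (by positivity)
    refine h4.congr_deriv ?_
    have hq := Real.sqrt_pos.2 h0
    have hq2 := Real.sq_sqrt h0.le
    set q := Real.sqrt (r ^ 2 - s ^ 2)
    field_simp
    rw [hq2]; ring
  have hnn : ∀ r ∈ Set.Ioi s, 0 ≤ 1 / (r ^ 2 * Real.sqrt (r ^ 2 - s ^ 2)) := by
    intro r _; positivity
  have hlim : Tendsto (fun r : ℝ => Real.sqrt (r ^ 2 - s ^ 2) / (s ^ 2 * r)) atTop
      (𝓝 (1 / s ^ 2)) := by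
    have h1 : Tendsto (fun r : ℝ => Real.sqrt (1 - s ^ 2 * (r⁻¹) ^ 2) / s ^ 2) atTop
        (𝓝 (Real.sqrt (1 - s ^ 2 * 0 ^ 2) / s ^ 2)) := by
      apply Tendsto.div_const
      apply (Real.continuous_sqrt.tendsto _).comp
      exact ((tendsto_inv_atTop_zero.pow 2).const_mul _).const_sub _
    simp only [ne_eq, OfNat.ofNat_ne_zero, not_false_eq_true, zero_pow, mul_zero, sub_zero,
      Real.sqrt_one] at h1
    refine h1.congr' ?_
    filter_upwards [eventually_gt_atTop 0] with r hr
    have : r ^ 2 - s ^ 2 = r ^ 2 * (1 - s ^ 2 * (r⁻¹) ^ 2) := by field_simp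
    rw [this, Real.sqrt_mul (by positivity), Real.sqrt_sq hr.le]
    field_simp
  refine ⟨integrableOn_Ioi_deriv_of_nonneg hc hd hnn hlim, ?_⟩
  rw [integral_Ioi_of_hasDerivAt_of_nonneg hc hd hnn hlim]
  simp

lemma aux_sqrt (s b : ℝ) (hs : s ≤ b) :
    IntegrableOn (fun r : ℝ => 1 / Real.sqrt (r - s)) (Set.Ioc s b) ∧
    ∫ r in Set.Ioc s b, 1 / Real.sqrt (r - s) = 2 * Real.sqrt (b - s) := by
  have hc : ContinuousOn (fun r : ℝ => 2 * Real.sqrt (r - s)) (Set.Icc s b) := by fun_prop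
  have hd : ∀ r ∈ Set.Ioo s b, HasDerivAt (fun r : ℝ => 2 * Real.sqrt (r - s))
      (1 / Real.sqrt (r - s)) r := by
    intro r hr
    have h0 : 0 < r - s := by linarith [hr.1]
    have h2 := (((hasDerivAt_id r).sub_const s).sqrt h0.ne').const_mul 2
    refine h2.congr_deriv ?_
    have hq := Real.sqrt_pos.2 h0
    simp only [id]
    field_simp
  have hi := intervalIntegral.integrableOn_deriv_of_nonneg hc hd (fun r _ => by positivity)
  refine ⟨hi, ?_⟩
  rw [← intervalIntegral.integral_of_le hs,
    intervalIntegral.integral_eq_sub_of_hasDerivAt_of_le hs hc hd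
      ((intervalIntegrable_iff_integrableOn_Ioc_of_le hs).2 hi)]
  simp

lemma aux_log_s16 (s b : ℝ) (h1 : 1 < s) (hs : s ≤ b) :
    IntegrableOn (fun r : ℝ => 1 / Real.sqrt ((r - s) * (r - 1))) (Set.Ioc s b) ∧
    ∫ r in Set.Ioc s b, 1 / Real.sqrt ((r - s) * (r - 1)) =
      2 * Real.log (Real.sqrt (b - s) + Real.sqrt (b - 1)) - Real.log (s - 1) := by
  have hpos : ∀ r, s ≤ r → 0 < Real.sqrt (r - s) + Real.sqrt (r - 1) := by
    intro r hr
    have := Real.sqrt_pos.2 (show 0 < r - 1 by linarith)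
    positivity
  have hc : ContinuousOn (fun r : ℝ => 2 * Real.log (Real.sqrt (r - s) + Real.sqrt (r - 1)))
      (Set.Icc s b) := by
    apply ContinuousOn.mul continuousOn_const
    apply ContinuousOn.log
    · fun_prop
    · intro r hr; exact (hpos r hr.1).ne'
  have hd : ∀ r ∈ Set.Ioo s b,
      HasDerivAt (fun r : ℝ => 2 * Real.log (Real.sqrt (r - s) + Real.sqrt (r - 1)))
      (1 / Real.sqrt ((r - s) * (r - 1))) r := by
    intro r hr
    have h0 : 0 < r - s := by linarith [hr.1]
    have h0' : 0 < r - 1 := by linarith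
    have e1 := ((hasDerivAt_id r).sub_const s).sqrt h0.ne'
    have e2 := ((hasDerivAt_id r).sub_const 1).sqrt h0'.ne'
    have h2 := ((e1.add e2).log (hpos r hr.1.le).ne').const_mul 2
    refine h2.congr_deriv ?_
    have hq := Real.sqrt_pos.2 h0
    have hq' := Real.sqrt_pos.2 h0'
    rw [Real.sqrt_mul h0.le]
    simp only [id, Pi.add_apply]
    field_simp
    try ring
  have hi := intervalIntegral.integrableOn_deriv_of_nonneg hc hd (fun r _ => by positivity)
  refine ⟨hi, ?_⟩
  rw [← intervalIntegral.integral_of_le hs,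
    intervalIntegral.integral_eq_sub_of_hasDerivAt_of_le hs hc hd
      ((intervalIntegrable_iff_integrableOn_Ioc_of_le hs).2 hi)]
  simp only [sub_self, Real.sqrt_zero, zero_add]
  rw [Real.log_sqrt (by linarith)]
  ring

/-- the integrand -/
noncomputable def auxF (d : ℕ) (s r : ℝ) : ℝ :=
  r ^ (((d : ℝ) - 5) / 2) / Real.sqrt ((r ^ 2 - s ^ 2) * (r ^ (d - 1) - 1))

/-- the regular factor -/
noncomputable def auxH (d : ℕ) (p : ℝ × ℝ) : ℝ :=
  p.1 ^ (((d : ℝ) - 5) / 2) / Real.sqrt ((p.1 + p.2) * ∑ i ∈ Finset.range (d - 1), p.1 ^ i)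

lemma auxF_nonneg (d : ℕ) (s r : ℝ) (hr : 0 ≤ r) : 0 ≤ auxF d s r := by
  unfold auxF; positivity

lemma auxF_meas (d : ℕ) (s : ℝ) : Measurable (auxF d s) := by
  unfold auxF; fun_prop

lemma auxF_le (d : ℕ) (hd : 4 ≤ d) (s b r : ℝ) (hs : 1 < s) (hb : s ≤ b) (hr : b < r) :
    auxF d s r ≤ (1 / Real.sqrt (1 - (b ^ (d - 1))⁻¹)) *
      (1 / (r ^ 2 * Real.sqrt (r ^ 2 - s ^ 2))) := by
  unfold auxF
  have hr0 : 0 < r := by linarith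
  have hb0 : 0 < b := by linarith
  have h0 : 0 < r ^ 2 - s ^ 2 := by nlinarith
  have hbn : 1 < b ^ (d - 1) := one_lt_pow₀ (by linarith) (by omega)
  have hA : 0 < 1 - (b ^ (d - 1))⁻¹ := by
    have := inv_lt_one_of_one_lt₀ hbn; linarith
  have hbr : b ^ (d - 1) ≤ r ^ (d - 1) := by gcongr
  have h1 : r ^ (d - 1) * (1 - (b ^ (d - 1))⁻¹) ≤ r ^ (d - 1) - 1 := by
    have : 1 ≤ r ^ (d - 1) * (b ^ (d - 1))⁻¹ := by
      rw [← div_eq_mul_inv, le_div_iff₀ (by positivity)]; linarith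
    linarith
  have hrs : Real.sqrt (r ^ (d - 1)) = r ^ (((d : ℝ) - 1) / 2) := by
    rw [Real.sqrt_eq_rpow, ← Real.rpow_natCast, ← Real.rpow_mul hr0.le]
    congr 1
    rw [Nat.cast_sub (by omega)]; push_cast; ring
  have hpw : r ^ (((d : ℝ) - 5) / 2) * r ^ 2 = r ^ (((d : ℝ) - 1) / 2) := by
    rw [← Real.rpow_natCast r 2, ← Real.rpow_add hr0]
    congr 1; push_cast; ring
  rw [Real.sqrt_mul h0.le]
  have hq := Real.sqrt_pos.2 h0
  have hqA := Real.sqrt_pos.2 hA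
  have h2 := Real.sqrt_le_sqrt h1
  rw [Real.sqrt_mul (by positivity), hrs, ← hpw] at h2
  have hrp : 0 < r ^ (((d : ℝ) - 5) / 2) := by positivity
  calc _ ≤ r ^ (((d : ℝ) - 5) / 2) / (Real.sqrt (r ^ 2 - s ^ 2) *
        (r ^ (((d : ℝ) - 5) / 2) * r ^ 2 * Real.sqrt (1 - (b ^ (d - 1))⁻¹))) := by gcongr
    _ = _ := by field_simp

lemma auxF_int (d : ℕ) (hd : 4 ≤ d) (s : ℝ) (hs : 1 < s) :
    IntegrableOn (auxF d s) (Set.Ioi s) := by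
  refine Integrable.mono' ((aux_dom s hs).1.const_mul (1 / Real.sqrt (1 - (s ^ (d - 1))⁻¹)))
    (auxF_meas d s).aestronglyMeasurable ?_
  filter_upwards [ae_restrict_mem measurableSet_Ioi] with r hr
  have hr' : s < r := hr
  rw [Real.norm_of_nonneg (auxF_nonneg d s r (by linarith))]
  exact auxF_le d hd s s r hs le_rfl hr

lemma auxF_eq (d : ℕ) (s r : ℝ) (hs : 1 < s) (hr : s < r) :
    auxF d s r = auxH d (r, s) * (1 / Real.sqrt ((r - s) * (r - 1))) := by
  unfold auxF auxH
  have hr0 : 0 < r := by linarith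
  have h : (r ^ 2 - s ^ 2) * (r ^ (d - 1) - 1) =
      ((r + s) * ∑ i ∈ Finset.range (d - 1), r ^ i) * ((r - s) * (r - 1)) := by
    rw [← geom_sum_mul]; ring
  have h0 : 0 ≤ (r + s) * ∑ i ∈ Finset.range (d - 1), r ^ i := by
    have : 0 ≤ ∑ i ∈ Finset.range (d - 1), r ^ i := Finset.sum_nonneg fun i _ => by positivity
    have : 0 ≤ r + s := by linarith
    positivity
  rw [h, Real.sqrt_mul h0, div_mul_div_comm, mul_one]

lemma auxH_one (d : ℕ) (hd : 4 ≤ d) : 2 * auxH d (1, 1) = Real.sqrt (2 / ((d : ℝ) - 1)) := by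
  have : (0:ℝ) < (d : ℝ) - 1 := by
    have : (4 : ℝ) ≤ d := by exact_mod_cast hd
    linarith
  unfold auxH
  simp only [Real.one_rpow, one_pow, Finset.sum_const, Finset.card_range, nsmul_eq_mul, mul_one]
  rw [Nat.cast_sub (by omega), Nat.cast_one]
  symm
  rw [Real.sqrt_eq_iff_eq_sq (by positivity) (by positivity), mul_pow, div_pow,
    Real.sq_sqrt (by positivity)]
  field_simp
  norm_num

lemma auxH_lip (d : ℕ) (hd : 4 ≤ d) : ∃ K > 0, ∃ b, 1 < b ∧ b ≤ 2 ∧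
    ∀ s r, 1 < s → s < r → r ≤ b → |auxH d (r, s) - auxH d (1, 1)| ≤ K * (r - 1) := by
  have hdiff : DifferentiableAt ℝ (auxH d) (1, 1) := by
    unfold auxH
    simp only [div_eq_mul_inv _ (Real.sqrt _)]
    have hpos : (0:ℝ) < ((1:ℝ) + 1) * ∑ i ∈ Finset.range (d - 1), (1:ℝ) ^ i := by
      simp only [one_pow, Finset.sum_const, Finset.card_range, nsmul_eq_mul, mul_one]
      have : 0 < d - 1 := by omega
      positivity
    apply DifferentiableAt.fun_mul
    · exact DifferentiableAt.rpow_const (by fun_prop) (by simp)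
    · refine DifferentiableAt.fun_inv (DifferentiableAt.sqrt ?_ ?_) ?_
      · fun_prop
      · exact hpos.ne'
      exact (Real.sqrt_pos.2 hpos).ne'
  obtain ⟨K, hK, hO⟩ := hdiff.isBigO_sub.exists_pos
  rw [Asymptotics.isBigOWith_iff, Metric.eventually_nhds_iff] at hO
  obtain ⟨ε, hε, hO⟩ := hO
  refine ⟨K, hK, 1 + min (ε / 2) 1, by have : 0 < min (ε / 2) 1 := by positivity
                                       linarith, by linarith [min_le_right (ε / 2) 1], ?_⟩
  intro s r hs hr hb
  have hm := min_le_left (ε / 2) 1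
  have hn : ‖((r, s) : ℝ × ℝ) - (1, 1)‖ = r - 1 := by
    rw [Prod.mk_sub_mk, Prod.norm_mk, Real.norm_of_nonneg (by linarith),
      Real.norm_of_nonneg (by linarith)]
    exact max_eq_left (by linarith)
  have := hO (y := (r, s)) (by rw [dist_eq_norm, hn]; linarith)
  rw [hn] at this
  exact this

lemma aux_main_s16 (d : ℕ) (hd : 4 ≤ d) : ∃ b, 1 < b ∧ ∃ M, ∀ s, 1 < s → s < b →
    |(∫ r in Set.Ioi s, auxF d s r) - auxH d (1, 1) * (-Real.log (s - 1))| ≤ M := by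
  obtain ⟨K, hK, b, hb1, hb2, hlip⟩ := auxH_lip d hd
  have hc0 : 0 ≤ auxH d (1, 1) := by
    have := auxH_one d hd
    have := Real.sqrt_nonneg (2 / ((d : ℝ) - 1))
    linarith
  set c := auxH d (1, 1) with hc
  set A := 1 / Real.sqrt (1 - (b ^ (d - 1))⁻¹) with hA
  have hA0 : 0 ≤ A := by positivity
  refine ⟨b, hb1, K * 2 + A + c * (2 * (|Real.log (Real.sqrt (b - 1))| + Real.log 2)), ?_⟩
  intro s hs hsb
  have hF := auxF_int d hd s hs
  have hF1 : IntegrableOn (auxF d s) (Set.Ioc s b) := hF.mono_set Set.Ioc_subset_Ioi_self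
  have hF2 : IntegrableOn (auxF d s) (Set.Ioi b) := hF.mono_set (Set.Ioi_subset_Ioi hsb.le)
  have hsplit : ∫ r in Set.Ioi s, auxF d s r =
      (∫ r in Set.Ioc s b, auxF d s r) + ∫ r in Set.Ioi b, auxF d s r := by
    rw [← setIntegral_union (Set.Ioc_disjoint_Ioi le_rfl) measurableSet_Ioi hF1 hF2,
      Set.Ioc_union_Ioi_eq_Ioi hsb.le]
  obtain ⟨hD1, hD2⟩ := aux_dom s hs
  obtain ⟨hL1, hL2⟩ := aux_log_s16 s b hs hsb.le
  obtain ⟨hS1, hS2⟩ := aux_sqrt s b hsb.le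
  have htail0 : 0 ≤ ∫ r in Set.Ioi b, auxF d s r :=
    setIntegral_nonneg measurableSet_Ioi fun r hr =>
      auxF_nonneg d s r (by have : b < r := hr
                            linarith)
  have htail : ∫ r in Set.Ioi b, auxF d s r ≤ A := by
    calc _ ≤ ∫ r in Set.Ioi b, A * (1 / (r ^ 2 * Real.sqrt (r ^ 2 - s ^ 2))) :=
          setIntegral_mono_on hF2 ((hD1.mono_set (Set.Ioi_subset_Ioi hsb.le)).const_mul A)
            measurableSet_Ioi fun r hr => auxF_le d hd s b r hs hsb.le hr
      _ = A * ∫ r in Set.Ioi b, (1 / (r ^ 2 * Real.sqrt (r ^ 2 - s ^ 2))) :=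
          integral_const_mul _ _
      _ ≤ A * ∫ r in Set.Ioi s, (1 / (r ^ 2 * Real.sqrt (r ^ 2 - s ^ 2))) := by
          apply mul_le_mul_of_nonneg_left _ hA0
          apply setIntegral_mono_set hD1
          · exact Eventually.of_forall fun r => by simp only [Pi.zero_apply]; positivity
          · exact (Set.Ioi_subset_Ioi hsb.le).eventuallyLE
      _ ≤ A * 1 := by
          rw [hD2]
          apply mul_le_mul_of_nonneg_left _ hA0
          rw [div_le_one (by positivity)]
          exact one_le_pow₀ hs.le
      _ = A := mul_one A
  have hnear : |(∫ r in Set.Ioc s b, auxF d s r) -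
      c * ∫ r in Set.Ioc s b, 1 / Real.sqrt ((r - s) * (r - 1))| ≤ K * 2 := by
    rw [← integral_const_mul, ← integral_sub hF1 (hL1.const_mul c), ← Real.norm_eq_abs]
    calc _ ≤ ∫ r in Set.Ioc s b, K * (1 / Real.sqrt (r - s)) := by
          apply norm_integral_le_of_norm_le (hS1.const_mul K)
          filter_upwards [ae_restrict_mem measurableSet_Ioc] with r hr
          have h0 : 0 < r - s := by linarith [hr.1]
          have h1 : 0 < r - 1 := by linarith
          rw [auxF_eq d s r hs hr.1, ← sub_mul, norm_mul, Real.norm_eq_abs,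
            Real.norm_of_nonneg (by positivity), Real.sqrt_mul h0.le]
          have hq := Real.sqrt_pos.2 h0
          have hq' := Real.sqrt_pos.2 h1
          have hq1 : Real.sqrt (r - 1) ≤ 1 := by
            refine Real.sqrt_le_iff.2 ⟨by norm_num, ?_⟩; linarith [hr.2]
          have hsq := Real.sq_sqrt h1.le
          calc _ ≤ K * (r - 1) * (1 / (Real.sqrt (r - s) * Real.sqrt (r - 1))) := by
                gcongr
                exact hlip s r hs hr.1 hr.2
            _ = K * (1 / Real.sqrt (r - s)) * Real.sqrt (r - 1) := by
                field_simp; rw [hsq]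
            _ ≤ K * (1 / Real.sqrt (r - s)) * 1 := by gcongr
            _ = _ := mul_one _
      _ = K * (2 * Real.sqrt (b - s)) := by rw [integral_const_mul, hS2]
      _ ≤ K * 2 := by
          have : Real.sqrt (b - s) ≤ 1 := by
            refine Real.sqrt_le_iff.2 ⟨by norm_num, ?_⟩; linarith
          gcongr; linarith
  set X := Real.sqrt (b - s) + Real.sqrt (b - 1) with hX
  have hqb := Real.sqrt_pos.2 (show 0 < b - 1 by linarith)
  have hX1 : Real.sqrt (b - 1) ≤ X := by
    have := Real.sqrt_nonneg (b - s); linarith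
  have hX2 : X ≤ 2 := by
    have h1 : Real.sqrt (b - s) ≤ 1 := by refine Real.sqrt_le_iff.2 ⟨by norm_num, ?_⟩; linarith
    have h2 : Real.sqrt (b - 1) ≤ 1 := by refine Real.sqrt_le_iff.2 ⟨by norm_num, ?_⟩; linarith
    linarith
  have hl1 := Real.log_le_log hqb hX1
  have hl2 := Real.log_le_log (by linarith) hX2
  have hlogX : |Real.log X| ≤ |Real.log (Real.sqrt (b - 1))| + Real.log 2 := by
    have h2 := Real.log_pos (show (1:ℝ) < 2 by norm_num)
    rw [abs_le]
    constructor
    · linarith [neg_abs_le (Real.log (Real.sqrt (b - 1)))]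
    · linarith [abs_nonneg (Real.log (Real.sqrt (b - 1)))]
  rw [hL2] at hnear
  rw [hsplit]
  have hid : (∫ r in Set.Ioc s b, auxF d s r) + (∫ r in Set.Ioi b, auxF d s r)
      - c * (-Real.log (s - 1)) =
      ((∫ r in Set.Ioc s b, auxF d s r) - c * (2 * Real.log X - Real.log (s - 1))) +
      (∫ r in Set.Ioi b, auxF d s r) + c * (2 * Real.log X) := by ring
  rw [hid]
  refine (abs_add_three _ _ _).trans ?_
  rw [abs_of_nonneg htail0, abs_mul c, abs_of_nonneg hc0, abs_mul 2, abs_of_pos (two_pos : (0:ℝ) < 2)]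
  gcongr

/-- For d ≥ 4 and
Δx(s) = 2s·∫_s^∞ r^{(d−5)/2} dr/√((r²−s²)(r^{d−1}−1)) (s > 1),
the integral converges and Δx(s)/(−ln(s−1)) → √(2/(d−1)) as s → 1⁺. -/
theorem stmt_16 (d : ℕ) (hd : 4 ≤ d) :
    (∀ s : ℝ, 1 < s → IntegrableOn
        (fun r : ℝ => r ^ (((d : ℝ) - 5) / 2)
          / Real.sqrt ((r ^ 2 - s ^ 2) * (r ^ (d - 1) - 1)))
        (Set.Ioi s)) ∧
    Tendsto (fun s : ℝ =>
        (2 * s * ∫ r in Set.Ioi s, r ^ (((d : ℝ) - 5) / 2)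
            / Real.sqrt ((r ^ 2 - s ^ 2) * (r ^ (d - 1) - 1)))
          / (-Real.log (s - 1)))
      (nhdsWithin 1 (Set.Ioi (1 : ℝ)))
      (nhds (Real.sqrt (2 / ((d : ℝ) - 1)))) := by
  refine ⟨fun s hs => auxF_int d hd s hs, ?_⟩
  change Tendsto (fun s : ℝ => (2 * s * ∫ r in Set.Ioi s, auxF d s r) / (-Real.log (s - 1))) _ _
  obtain ⟨b, hb, M, hM⟩ := aux_main_s16 d hd
  set c := auxH d (1, 1) with hc
  have hsub : Tendsto (fun s : ℝ => s - 1) (𝓝[>] 1) (𝓝[>] 0) := by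
    apply tendsto_nhdsWithin_of_tendsto_nhds_of_eventually_within
    · have : Tendsto (fun s : ℝ => s - 1) (𝓝 1) (𝓝 (1 - 1)) :=
        (continuous_id.sub continuous_const).tendsto 1
      rw [sub_self] at this
      exact this.mono_left nhdsWithin_le_nhds
    · filter_upwards [self_mem_nhdsWithin] with s hs
      have : (1:ℝ) < s := hs
      simpa using this
  have hL : Tendsto (fun s : ℝ => -Real.log (s - 1)) (𝓝[>] 1) atTop :=
    tendsto_neg_atBot_atTop.comp (Real.tendsto_log_nhdsGT_zero.comp hsub)
  have hmem : ∀ᶠ s : ℝ in 𝓝[>] 1, 1 < s ∧ s < b := Ioo_mem_nhdsGT hb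
  have hz : Tendsto (fun s : ℝ => ((∫ r in Set.Ioi s, auxF d s r) - c * (-Real.log (s - 1))) /
      (-Real.log (s - 1))) (𝓝[>] 1) (𝓝 0) := by
    apply squeeze_zero_norm' _ (hL.const_div_atTop M)
    filter_upwards [hmem, hL.eventually_gt_atTop 0] with s hs hl
    rw [norm_div, Real.norm_eq_abs, Real.norm_of_nonneg hl.le]
    gcongr
    exact hM s hs.1 hs.2
  have hs1 : Tendsto (fun s : ℝ => 2 * s) (𝓝[>] 1) (𝓝 (2 * 1)) :=
    (tendsto_id.const_mul 2).mono_left nhdsWithin_le_nhds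
  have hfin := hs1.mul (hz.add_const c)
  rw [← auxH_one d hd]
  rw [mul_one, zero_add] at hfin
  refine hfin.congr' ?_
  filter_upwards [hL.eventually_gt_atTop 0] with s hl
  have hl' := hl.ne'
  generalize -Real.log (s - 1) = L at *
  field_simp
  ring
end

section
/- Let d ≥ 4 be an integer. For s > 1 define L_ren(s) = 2·ln(2/s) + 2·∫_s^∞ [ r^{(d−1)/2} / √((r² − s²)·(r^{d−1} − 1)) − 1/√(r² − s²) ] dr. Then the integral converges for every s > 1, and L_ren(s) / (−ln(s − 1)) → √(2/(d−1)) as s → 1⁺. -/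
open Real Filter Topology MeasureTheory

/-- The integrand with `d - 1 = n`. -/
noncomputable def fAux (n : ℕ) (s r : ℝ) : ℝ :=
  √(r ^ n) / √((r ^ 2 - s ^ 2) * (r ^ n - 1)) - 1 / √(r ^ 2 - s ^ 2)

noncomputable def gAux (n : ℕ) (r s : ℝ) : ℝ :=
  (√(r ^ n) / √(∑ i ∈ Finset.range n, r ^ i) - √(r - 1)) / √(r + s)

noncomputable def tAux (s r : ℝ) : ℝ := 1 / ((r - 1) * √(r - s))

lemma fAux_eq (n : ℕ) (hn : 3 ≤ n) (s r : ℝ) (hs : 1 < s) (hr : s < r) :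
    fAux n s r = gAux n r s * (1 / (√(r - s) * √(r - 1))) := by
  have hr0 : 0 < r := by linarith
  have hS : 0 < ∑ i ∈ Finset.range n, r ^ i :=
    Finset.sum_pos (fun i _ => by positivity) ⟨0, by simp; omega⟩
  have h1 : r ^ n - 1 = (r - 1) * ∑ i ∈ Finset.range n, r ^ i := by
    rw [mul_comm, geom_sum_mul]
  have h2 : r ^ 2 - s ^ 2 = (r - s) * (r + s) := by ring
  have a1 : 0 < r - s := by linarith
  have a2 : 0 < r + s := by linarith
  have a3 : 0 < r - 1 := by linarith
  unfold fAux gAux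
  rw [h1, h2, Real.sqrt_mul (by positivity), Real.sqrt_mul (by positivity),
    Real.sqrt_mul (by positivity)]
  have b1 := Real.sqrt_pos.2 a1
  have b2 := Real.sqrt_pos.2 a2
  have b3 := Real.sqrt_pos.2 a3
  have b4 := Real.sqrt_pos.2 hS
  field_simp

lemma fAux_bound (n : ℕ) (hn : 3 ≤ n) (s r : ℝ) (hs : 1 < s) (hr : s < r) :
    0 ≤ fAux n s r ∧ fAux n s r ≤ tAux s r := by
  have hr1 : 1 < r := by linarith
  have a1 : 0 < r - s := by linarith
  have hp : r ≤ r ^ n := le_self_pow₀ hr1.le (by omega)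
  have a4 : 0 < r ^ n - 1 := by linarith
  have a5 : 0 < r ^ 2 - s ^ 2 := by nlinarith
  have b1 := Real.sqrt_pos.2 a1
  have b4 := Real.sqrt_pos.2 a4
  have b5 := Real.sqrt_pos.2 a5
  have e : fAux n s r = (√(r ^ n) / √(r ^ n - 1) - 1) * (1 / √(r ^ 2 - s ^ 2)) := by
    unfold fAux
    rw [Real.sqrt_mul a5.le]
    field_simp
  have hle : √(r ^ n - 1) ≤ √(r ^ n) := Real.sqrt_le_sqrt (by linarith)
  have h1 : 1 ≤ √(r ^ n) / √(r ^ n - 1) := by rwa [le_div_iff₀ b4, one_mul]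
  have hsq : (√(r ^ n) / √(r ^ n - 1)) ^ 2 = 1 + 1 / (r ^ n - 1) := by
    rw [div_pow, Real.sq_sqrt (by linarith), Real.sq_sqrt a4.le]
    field_simp
    ring
  have h2 : √(r ^ n) / √(r ^ n - 1) - 1 ≤ 1 / (r ^ n - 1) := by nlinarith
  have h3 : 1 / (r ^ n - 1) ≤ 1 / (r - 1) :=
    one_div_le_one_div_of_le (by linarith) (by linarith)
  have h4 : 1 / √(r ^ 2 - s ^ 2) ≤ 1 / √(r - s) :=
    one_div_le_one_div_of_le b1 (Real.sqrt_le_sqrt (by nlinarith))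
  constructor
  · rw [e]; exact mul_nonneg (by linarith) (by positivity)
  · rw [e]
    have : tAux s r = 1 / (r - 1) * (1 / √(r - s)) := by
      unfold tAux; rw [one_div_mul_one_div]
    rw [this]
    exact mul_le_mul (h2.trans h3) h4 (by positivity) (one_div_nonneg.2 (by linarith))

lemma tAux_integrable (s : ℝ) (hs : 1 < s) : IntegrableOn (tAux s) (Set.Ioi s) := by
  have h0 : 0 < s - 1 := by linarith
  have b0 := Real.sqrt_pos.2 h0
  refine integrableOn_Ioi_deriv_of_nonneg
    (g := fun r => 2 / √(s - 1) * Real.arctan (√(r - s) / √(s - 1)))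
    (l := 2 / √(s - 1) * (π / 2)) ?_ ?_ ?_ ?_
  · apply Continuous.continuousWithinAt
    have := Real.continuous_arctan
    fun_prop
  · intro r hr
    have hr : s < r := hr
    have a1 : 0 < r - s := by linarith
    have b1 := Real.sqrt_pos.2 a1
    have hd := ((((hasDerivAt_id r).sub_const s).sqrt (by simpa using a1.ne')).div_const
      (√(s - 1))).arctan.const_mul (2 / √(s - 1))
    refine hd.congr_deriv ?_
    symm
    unfold tAux
    simp only [id]
    rw [div_pow, Real.sq_sqrt a1.le, Real.sq_sqrt h0.le]
    have h5 : 1 + (r - s) / (s - 1) = (r - 1) / (s - 1) := by field_simp; ring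
    rw [h5]
    have a3 : 0 < r - 1 := by linarith
    have : s - 1 = √(s - 1) ^ 2 := (Real.sq_sqrt h0.le).symm
    have h6 : (r - 1) / (s - 1) = (r - 1) / √(s - 1) ^ 2 := by rw [Real.sq_sqrt h0.le]
    rw [h6]
    field_simp
  · intro r hr
    have hr : s < r := hr
    unfold tAux
    exact one_div_nonneg.2 (mul_nonneg (by linarith) (Real.sqrt_nonneg _))
  · refine Tendsto.const_mul _ ?_
    refine (Real.tendsto_arctan_atTop.mono_right nhdsWithin_le_nhds).comp ?_
    refine Tendsto.atTop_div_const b0 ?_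
    exact Real.tendsto_sqrt_atTop.comp (tendsto_atTop_add_const_right _ (-s) tendsto_id)

lemma fAux_integrable (n : ℕ) (hn : 3 ≤ n) (s : ℝ) (hs : 1 < s) :
    IntegrableOn (fAux n s) (Set.Ioi s) := by
  refine Integrable.mono' (tAux_integrable s hs) ?_ ?_
  · apply Measurable.aestronglyMeasurable
    unfold fAux
    fun_prop
  · refine (ae_restrict_iff' measurableSet_Ioi).2 (Eventually.of_forall fun r hr => ?_)
    have := fAux_bound n hn s r hs hr
    rw [Real.norm_of_nonneg this.1]
    exact this.2

lemma J_aux (s b : ℝ) (hs : 1 < s) (hb : s < b) :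
    IntegrableOn (fun r => 1 / (√(r - s) * √(r - 1))) (Set.Ioc s b) ∧
    ∫ r in Set.Ioc s b, 1 / (√(r - s) * √(r - 1)) =
      2 * Real.log (√(b - s) + √(b - 1)) - Real.log (s - 1) := by
  have hc : ContinuousOn (fun r => 2 * Real.log (√(r - s) + √(r - 1))) (Set.Icc s b) := by
    refine ContinuousOn.mul continuousOn_const (ContinuousOn.log (by fun_prop) ?_)
    intro r hr
    have : 0 < √(r - 1) := Real.sqrt_pos.2 (by linarith [hr.1])
    have := Real.sqrt_nonneg (r - s)
    positivity
  have hd : ∀ r ∈ Set.Ioo s b, HasDerivAt (fun r => 2 * Real.log (√(r - s) + √(r - 1)))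
      (1 / (√(r - s) * √(r - 1))) r := by
    intro r hr
    have a1 : 0 < r - s := by linarith [hr.1]
    have a3 : 0 < r - 1 := by linarith [hr.1]
    have b1 := Real.sqrt_pos.2 a1
    have b3 := Real.sqrt_pos.2 a3
    have h := (((((hasDerivAt_id r).sub_const s).sqrt (by simpa using a1.ne')).add
      (((hasDerivAt_id r).sub_const 1).sqrt (by simpa using a3.ne'))).log
        (by simp only [Pi.add_apply, id]; positivity)).const_mul 2
    refine h.congr_deriv ?_
    simp only [Pi.add_apply, id]
    field_simp
    ring
  have hi : IntegrableOn (fun r => 1 / (√(r - s) * √(r - 1))) (Set.Ioc s b) :=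
    intervalIntegral.integrableOn_deriv_of_nonneg hc hd (fun r _ => by positivity)
  refine ⟨hi, ?_⟩
  rw [← intervalIntegral.integral_of_le hb.le,
    intervalIntegral.integral_eq_sub_of_hasDerivAt_of_le hb.le hc hd
      ((intervalIntegrable_iff_integrableOn_Ioc_of_le hb.le).2 hi)]
  simp only [sub_self, Real.sqrt_zero, zero_add]
  rw [Real.log_sqrt (by linarith)]
  ring

lemma gAux_near (n : ℕ) (hn : 3 ≤ n) (ε : ℝ) (hε : 0 < ε) :
    ∃ b > 1, ∀ s r, 1 < s → s < r → r ≤ b → |gAux n r s - 1 / √n / √2| < ε := by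
  have hc : ContinuousAt (fun p : ℝ × ℝ => gAux n p.1 p.2) (1, 1) := by
    unfold gAux
    have h1 : √(∑ i ∈ Finset.range n, (1:ℝ) ^ i) ≠ 0 := by
      simp; omega
    have h2 : √((1:ℝ) + 1) ≠ 0 := by positivity
    refine ContinuousAt.div (ContinuousAt.sub (ContinuousAt.div ?_ ?_ h1) ?_) ?_ h2 <;>
    · apply Continuous.continuousAt
      fun_prop
  have hv : gAux n 1 1 = 1 / √n / √2 := by
    unfold gAux
    norm_num
  obtain ⟨δ, hδ, h⟩ := Metric.continuousAt_iff.1 hc ε hε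
  refine ⟨1 + δ / 2, by linarith, fun s r h1 h2 h3 => ?_⟩
  have := @h (r, s) (by
    rw [Prod.dist_eq, max_lt_iff]
    simp only [Real.dist_eq]
    constructor <;> rw [abs_lt] <;> constructor <;> linarith)
  simp only [Real.dist_eq, hv] at this
  exact this

lemma I_bounds (n : ℕ) (hn : 3 ≤ n) (ε : ℝ) (hε : 0 < ε) :
    ∃ b > 1, ∃ K : ℝ, ∀ s, 1 < s → s < (1 + b) / 2 →
      (1 / √n / √2 - ε) * (2 * Real.log (√(b - s) + √(b - 1)) - Real.log (s - 1))
        ≤ ∫ r in Set.Ioi s, fAux n s r ∧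
      ∫ r in Set.Ioi s, fAux n s r ≤
      (1 / √n / √2 + ε) * (2 * Real.log (√(b - s) + √(b - 1)) - Real.log (s - 1)) + K := by
  obtain ⟨b, hb, h⟩ := gAux_near n hn ε hε
  refine ⟨b, hb, ∫ r in Set.Ioi b, tAux ((1 + b) / 2) r, fun s hs hsb => ?_⟩
  have hsb' : s < b := by linarith
  have hf := fAux_integrable n hn s hs
  have hsub1 : Set.Ioc s b ⊆ Set.Ioi s := fun x hx => hx.1
  have hsub2 : Set.Ioi b ⊆ Set.Ioi s := Set.Ioi_subset_Ioi hsb'.le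
  have hsplit : ∫ r in Set.Ioi s, fAux n s r =
      (∫ r in Set.Ioc s b, fAux n s r) + ∫ r in Set.Ioi b, fAux n s r := by
    rw [← setIntegral_union (Set.Ioc_disjoint_Ioi le_rfl) measurableSet_Ioi
      (hf.mono_set hsub1) (hf.mono_set hsub2), Set.Ioc_union_Ioi_eq_Ioi hsb'.le]
  obtain ⟨hJi, hJ⟩ := J_aux s b hs hsb'
  have t0 : 0 ≤ ∫ r in Set.Ioi b, fAux n s r :=
    setIntegral_nonneg measurableSet_Ioi fun r hr => (fAux_bound n hn s r hs (hsub2 hr)).1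
  have t1 : ∫ r in Set.Ioi b, fAux n s r ≤ ∫ r in Set.Ioi b, tAux ((1 + b) / 2) r := by
    refine setIntegral_mono_on (hf.mono_set hsub2)
      ((tAux_integrable _ (by linarith)).mono_set (Set.Ioi_subset_Ioi (by linarith)))
      measurableSet_Ioi fun r hr => ?_
    refine (fAux_bound n hn s r hs (hsub2 hr)).2.trans ?_
    have hr : b < r := hr
    unfold tAux
    have : 0 < √(r - (1 + b) / 2) := Real.sqrt_pos.2 (by linarith)
    have h1 : 0 < r - 1 := by linarith
    refine one_div_le_one_div_of_le (by positivity) ?_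
    exact mul_le_mul_of_nonneg_left (Real.sqrt_le_sqrt (by linarith)) h1.le
  have u0 : (1 / √n / √2 - ε) * (2 * Real.log (√(b - s) + √(b - 1)) - Real.log (s - 1))
      ≤ ∫ r in Set.Ioc s b, fAux n s r := by
    rw [← hJ, ← integral_const_mul]
    refine setIntegral_mono_on (hJi.const_mul _) (hf.mono_set hsub1) measurableSet_Ioc
      fun r hr => ?_
    rw [fAux_eq n hn s r hs hr.1]
    have := abs_lt.1 (h s r hs hr.1 hr.2)
    exact mul_le_mul_of_nonneg_right (by linarith) (by positivity)
  have u1 : ∫ r in Set.Ioc s b, fAux n s r ≤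
      (1 / √n / √2 + ε) * (2 * Real.log (√(b - s) + √(b - 1)) - Real.log (s - 1)) := by
    rw [← hJ, ← integral_const_mul]
    refine setIntegral_mono_on (hf.mono_set hsub1) (hJi.const_mul _) measurableSet_Ioc
      fun r hr => ?_
    rw [fAux_eq n hn s r hs hr.1]
    have := abs_lt.1 (h s r hs hr.1 hr.2)
    exact mul_le_mul_of_nonneg_right (by linarith) (by positivity)
  constructor <;> linarith

lemma L_atTop : Tendsto (fun s : ℝ => -Real.log (s - 1)) (𝓝[>] 1) atTop := by
  refine tendsto_neg_atBot_atTop.comp (Real.tendsto_log_nhdsGT_zero.comp ?_)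
  refine tendsto_nhdsWithin_iff.2 ⟨?_, ?_⟩
  · have : Tendsto (fun s : ℝ => s - 1) (𝓝 1) (𝓝 (1 - 1)) :=
      (continuous_id.sub continuous_const).tendsto 1
    rw [sub_self] at this
    exact this.mono_left nhdsWithin_le_nhds
  · filter_upwards [self_mem_nhdsWithin] with s hs
    have : (1:ℝ) < s := hs
    simpa using this

lemma I_tendsto (n : ℕ) (hn : 3 ≤ n) :
    Tendsto (fun s : ℝ => (∫ r in Set.Ioi s, fAux n s r) / (-Real.log (s - 1)))
      (𝓝[>] 1) (𝓝 (1 / √n / √2)) := by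
  have key : ∀ b > (1:ℝ), ∀ c K : ℝ, Tendsto (fun s : ℝ =>
      (c * (2 * Real.log (√(b - s) + √(b - 1)) - Real.log (s - 1)) + K) / (-Real.log (s - 1)))
      (𝓝[>] 1) (𝓝 c) := by
    intro b hb c K
    have hcont : ContinuousAt (fun s : ℝ => c * (2 * Real.log (√(b - s) + √(b - 1))) + K) 1 := by
      have : 0 < √(b - 1) := Real.sqrt_pos.2 (by linarith)
      refine ContinuousAt.add (ContinuousAt.mul continuousAt_const (ContinuousAt.mul
        continuousAt_const (ContinuousAt.log (Continuous.continuousAt (by fun_prop)) ?_)))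
        continuousAt_const
      positivity
    have h1 := (hcont.tendsto.mono_left
      (nhdsWithin_le_nhds (s := Set.Ioi 1))).div_atTop L_atTop
    have h2 := h1.add_const c
    rw [zero_add] at h2
    refine h2.congr' ?_
    filter_upwards [L_atTop.eventually_gt_atTop 0] with s hs
    have : Real.log (s - 1) ≠ 0 := by intro h; rw [h] at hs; simp at hs
    field_simp
    ring
  rw [tendsto_order]
  constructor
  · intro a ha
    obtain ⟨b, hb, K, h⟩ := I_bounds n hn ((1 / √n / √2 - a) / 2) (by linarith)
    have hk := (key b hb (1 / √n / √2 - (1 / √n / √2 - a) / 2) 0).eventually_const_lt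
      (u := a) (by linarith)
    have hlt : ∀ᶠ s in 𝓝[>] (1:ℝ), s < (1 + b) / 2 :=
      nhdsWithin_le_nhds (eventually_lt_nhds (by linarith))
    filter_upwards [hk, hlt, self_mem_nhdsWithin, L_atTop.eventually_gt_atTop 0]
      with s h1 h2 h3 h4
    refine h1.trans_le ?_
    rw [add_zero]
    exact div_le_div_of_nonneg_right (h s h3 h2).1 h4.le
  · intro a ha
    obtain ⟨b, hb, K, h⟩ := I_bounds n hn ((a - 1 / √n / √2) / 2) (by linarith)
    have hk := (key b hb (1 / √n / √2 + (a - 1 / √n / √2) / 2) K).eventually_lt_const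
      (u := a) (by linarith)
    have hlt : ∀ᶠ s in 𝓝[>] (1:ℝ), s < (1 + b) / 2 :=
      nhdsWithin_le_nhds (eventually_lt_nhds (by linarith))
    filter_upwards [hk, hlt, self_mem_nhdsWithin, L_atTop.eventually_gt_atTop 0]
      with s h1 h2 h3 h4
    refine lt_of_le_of_lt ?_ h1
    exact div_le_div_of_nonneg_right (h s h3 h2).2 h4.le

/-- For d ≥ 4 and
L_ren(s) = 2·ln(2/s) + 2·∫_s^∞ [r^{(d−1)/2}/√((r²−s²)(r^{d−1}−1)) − 1/√(r²−s²)] dr,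
the integral converges for every s > 1 and L_ren(s)/(−ln(s−1)) → √(2/(d−1)) as s → 1⁺. -/
theorem stmt_17 (d : ℕ) (hd : 4 ≤ d) :
    (∀ s : ℝ, 1 < s → IntegrableOn
        (fun r : ℝ => r ^ (((d : ℝ) - 1) / 2)
            / Real.sqrt ((r ^ 2 - s ^ 2) * (r ^ (d - 1) - 1))
          - 1 / Real.sqrt (r ^ 2 - s ^ 2))
        (Set.Ioi s)) ∧
    Tendsto (fun s : ℝ =>
        (2 * Real.log (2 / s)
          + 2 * ∫ r in Set.Ioi s, (r ^ (((d : ℝ) - 1) / 2)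
              / Real.sqrt ((r ^ 2 - s ^ 2) * (r ^ (d - 1) - 1))
            - 1 / Real.sqrt (r ^ 2 - s ^ 2)))
          / (-Real.log (s - 1)))
      (nhdsWithin 1 (Set.Ioi (1 : ℝ)))
      (nhds (Real.sqrt (2 / ((d : ℝ) - 1)))) := by
  obtain ⟨n, rfl⟩ : ∃ n, d = n + 1 := ⟨d - 1, by omega⟩
  have hn : 3 ≤ n := by omega
  have hcast : ((n + 1 : ℕ) : ℝ) - 1 = n := by push_cast; ring
  simp only [hcast, Nat.add_sub_cancel]
  have hpt : ∀ s : ℝ, 1 < s → ∀ r ∈ Set.Ioi s, fAux n s r =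
      r ^ ((n : ℝ) / 2) / Real.sqrt ((r ^ 2 - s ^ 2) * (r ^ n - 1))
          - 1 / Real.sqrt (r ^ 2 - s ^ 2) := by
    intro s hs r hr
    have hr0 : 0 ≤ r := by have : s < r := hr; linarith
    have : √(r ^ n) = r ^ ((n : ℝ) / 2) := by
      rw [Real.sqrt_eq_rpow, ← Real.rpow_natCast, ← Real.rpow_mul hr0]
      congr 1; ring
    rw [fAux, this]
  refine ⟨fun s hs => (fAux_integrable n hn s hs).congr_fun (hpt s hs) measurableSet_Ioi, ?_⟩
  have hlim : √(2 / (n:ℝ)) = 0 + 2 * (1 / √n / √2) := by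
    have : (0:ℝ) < n := by exact_mod_cast (by omega : 0 < n)
    have h2 : √2 * √2 = (2:ℝ) := Real.mul_self_sqrt (by norm_num)
    rw [Real.sqrt_div (by norm_num)]
    have := Real.sqrt_pos.2 this
    field_simp
    nlinarith
  rw [hlim]
  have hlog : ContinuousAt (fun s : ℝ => 2 * Real.log (2 / s)) 1 := by
    refine ContinuousAt.mul continuousAt_const (ContinuousAt.log
      (ContinuousAt.div continuousAt_const continuousAt_id one_ne_zero) (by norm_num))
  have h1 := (hlog.tendsto.mono_left
      (nhdsWithin_le_nhds (s := Set.Ioi 1))).div_atTop L_atTop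
  refine (h1.add ((I_tendsto n hn).const_mul 2)).congr' ?_
  filter_upwards [self_mem_nhdsWithin] with s hs
  rw [← setIntegral_congr_fun measurableSet_Ioi (hpt s hs), add_div, mul_div_assoc 2 (∫ r in Set.Ioi s, fAux n s r)]
end

section
/- Let d ≥ 4 be an integer and s > 1. Then: (i) the function r ↦ r^{(d−1)/2}/√((r² − s²)·(r^{d−1} − 1)) − 1/√(r² − s²) is (improperly) integrable on (s, ∞); and (ii) lim_{R→∞} [ 2·∫_s^R r^{(d−1)/2} dr / √((r² − s²)·(r^{d−1} − 1)) − 2·ln R ] = 2·ln(2/s) + 2·∫_s^∞ [ r^{(d−1)/2}/√((r² − s²)·(r^{d−1} − 1)) − 1/√(r² − s²) ] dr. -/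
open Real Filter Topology MeasureTheory

lemma aux_hasDeriv_sqrt (s : ℝ) (hs : 1 < s) (r : ℝ) (hr : s < r) :
    HasDerivAt (fun r : ℝ => Real.sqrt (r ^ 2 - s ^ 2)) (r / Real.sqrt (r ^ 2 - s ^ 2)) r := by
  have hpos : 0 < r ^ 2 - s ^ 2 := by nlinarith
  have h1 : HasDerivAt (fun r : ℝ => r ^ 2 - s ^ 2) (2 * r) r := by
    simpa using (hasDerivAt_pow 2 r).sub_const (s ^ 2)
  have h2 := h1.sqrt hpos.ne'
  convert h2 using 1
  field_simp

lemma aux_hasDeriv_log (s : ℝ) (hs : 1 < s) (r : ℝ) (hr : s < r) :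
    HasDerivAt (fun r : ℝ => Real.log (r + Real.sqrt (r ^ 2 - s ^ 2)))
      (1 / Real.sqrt (r ^ 2 - s ^ 2)) r := by
  have hpos : 0 < r ^ 2 - s ^ 2 := by nlinarith
  have hq := Real.sqrt_pos.2 hpos
  have hsum : 0 < r + Real.sqrt (r ^ 2 - s ^ 2) := by linarith
  have h := ((hasDerivAt_id r).add (aux_hasDeriv_sqrt s hs r hr)).log hsum.ne'
  refine HasDerivAt.congr_deriv h ?_
  change (1 + r / Real.sqrt (r ^ 2 - s ^ 2)) / (r + Real.sqrt (r ^ 2 - s ^ 2)) = _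
  field_simp
  ring

lemma aux_hasDeriv_quot (s : ℝ) (hs : 1 < s) (r : ℝ) (hr : s < r) :
    HasDerivAt (fun r : ℝ => Real.sqrt (r ^ 2 - s ^ 2) / r)
      (s ^ 2 * (1 / (r ^ 2 * Real.sqrt (r ^ 2 - s ^ 2)))) r := by
  have hpos : 0 < r ^ 2 - s ^ 2 := by nlinarith
  have hq := Real.sqrt_pos.2 hpos
  have hr0 : r ≠ 0 := by linarith
  have h := (aux_hasDeriv_sqrt s hs r hr).div (hasDerivAt_id r) hr0
  refine HasDerivAt.congr_deriv h ?_
  change (r / Real.sqrt (r ^ 2 - s ^ 2) * r - Real.sqrt (r ^ 2 - s ^ 2) * 1) / r ^ 2 = _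
  field_simp
  rw [Real.sq_sqrt hpos.le]
  ring

lemma aux_tendsto_quot (s : ℝ) (hs : 1 < s) :
    Tendsto (fun r : ℝ => Real.sqrt (r ^ 2 - s ^ 2) / r) atTop (𝓝 1) := by
  have h0 : Tendsto (fun r : ℝ => s ^ 2 / r ^ 2) atTop (𝓝 0) :=
    tendsto_const_nhds.div_atTop (tendsto_pow_atTop two_ne_zero)
  have h1 : Tendsto (fun r : ℝ => Real.sqrt (1 - s ^ 2 / r ^ 2)) atTop (𝓝 1) := by
    have := (tendsto_const_nhds (x := (1 : ℝ))).sub h0 |>.sqrt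
    simpa using this
  refine h1.congr' ?_
  filter_upwards [eventually_gt_atTop s] with r hr
  have hr0 : 0 < r := by linarith
  have e : 1 - s ^ 2 / r ^ 2 = (r ^ 2 - s ^ 2) / r ^ 2 := by field_simp
  rw [e, Real.sqrt_div' _ (by positivity), Real.sqrt_sq hr0.le]

lemma aux_integrable_dom (s : ℝ) (hs : 1 < s) :
    IntegrableOn (fun r : ℝ => s ^ 2 * (1 / (r ^ 2 * Real.sqrt (r ^ 2 - s ^ 2)))) (Set.Ioi s) := by
  refine integrableOn_Ioi_deriv_of_nonneg (g := fun r : ℝ => Real.sqrt (r ^ 2 - s ^ 2) / r)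
    (l := 1) ?_ (fun r hr => aux_hasDeriv_quot s hs r hr) (fun r _ => by positivity)
    (aux_tendsto_quot s hs)
  apply ContinuousAt.continuousWithinAt
  have : s ≠ 0 := by linarith
  fun_prop (disch := assumption)

lemma aux_bound_s18 (d : ℕ) (hd : 4 ≤ d) (s : ℝ) (hs : 1 < s) (r : ℝ) (hr : s < r) :
    ‖r ^ (((d : ℝ) - 1) / 2) / Real.sqrt ((r ^ 2 - s ^ 2) * (r ^ (d - 1) - 1))
        - 1 / Real.sqrt (r ^ 2 - s ^ 2)‖
      ≤ (1 / (s ^ 2 - 1)) * (s ^ 2 * (1 / (r ^ 2 * Real.sqrt (r ^ 2 - s ^ 2)))) := by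
  have hr0 : 0 < r := by linarith
  have hpos : 0 < r ^ 2 - s ^ 2 := by nlinarith
  have hq := Real.sqrt_pos.2 hpos
  have hx : r ^ 2 ≤ r ^ (d - 1) := pow_le_pow_right₀ (by linarith) (by omega)
  have hs1 : 0 < s ^ 2 - 1 := by nlinarith
  have hnum : r ^ (((d : ℝ) - 1) / 2) = Real.sqrt (r ^ (d - 1)) := by
    rw [Real.sqrt_eq_rpow, ← Real.rpow_natCast, ← Real.rpow_mul hr0.le, Nat.cast_sub (by omega)]
    congr 1
    push_cast
    ring
  rw [hnum, Real.sqrt_mul hpos.le]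
  generalize r ^ (d - 1) = x at *
  set q := Real.sqrt (r ^ 2 - s ^ 2)
  have hx1 : 0 < x - 1 := by linarith
  have hv := Real.sqrt_pos.2 hx1
  have huv : Real.sqrt (x - 1) ≤ Real.sqrt x := Real.sqrt_le_sqrt (by linarith)
  have hu2 : Real.sqrt x ^ 2 = x := Real.sq_sqrt (by linarith)
  have hv2 : Real.sqrt (x - 1) ^ 2 = x - 1 := Real.sq_sqrt hx1.le
  set u := Real.sqrt x
  set v := Real.sqrt (x - 1)
  have e : u / (q * v) - 1 / q = (u / v - 1) * (1 / q) := by field_simp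
  have h1 : 1 ≤ u / v := by rw [le_div_iff₀ hv]; linarith
  have h2 : u / v ≤ (u / v) ^ 2 := by nlinarith
  have h3 : (u / v) ^ 2 - 1 = 1 / (x - 1) := by
    rw [div_pow, hu2, hv2]; field_simp; ring
  have h4 : 1 / (x - 1) ≤ 1 / (s ^ 2 - 1) * (s ^ 2 / r ^ 2) := by
    rw [div_mul_div_comm, div_le_div_iff₀ hx1 (by positivity)]
    nlinarith
  rw [e, Real.norm_of_nonneg (mul_nonneg (by linarith) (by positivity))]
  calc (u / v - 1) * (1 / q) ≤ (1 / (s ^ 2 - 1) * (s ^ 2 / r ^ 2)) * (1 / q) := by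
        gcongr; linarith
    _ = _ := by field_simp

lemma aux_integrable (d : ℕ) (hd : 4 ≤ d) (s : ℝ) (hs : 1 < s) :
    IntegrableOn
      (fun r : ℝ => r ^ (((d : ℝ) - 1) / 2)
          / Real.sqrt ((r ^ 2 - s ^ 2) * (r ^ (d - 1) - 1))
        - 1 / Real.sqrt (r ^ 2 - s ^ 2))
      (Set.Ioi s) := by
  refine Integrable.mono' ((aux_integrable_dom s hs).const_mul (1 / (s ^ 2 - 1))) ?_ ?_
  · apply Measurable.aestronglyMeasurable
    fun_prop
  · filter_upwards [ae_restrict_mem measurableSet_Ioi] with r hr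
    exact aux_bound_s18 d hd s hs r hr

lemma aux_cont (s : ℝ) (hs : 1 < s) (R : ℝ) :
    ContinuousOn (fun r : ℝ => Real.log (r + Real.sqrt (r ^ 2 - s ^ 2))) (Set.Icc s R) := by
  apply ContinuousOn.log
  · fun_prop
  · intro r hr
    have := Real.sqrt_nonneg (r ^ 2 - s ^ 2)
    have := hr.1
    linarith

lemma aux_ii (s : ℝ) (hs : 1 < s) (R : ℝ) (hR : s ≤ R) :
    IntervalIntegrable (fun r : ℝ => 1 / Real.sqrt (r ^ 2 - s ^ 2)) volume s R := by
  rw [intervalIntegrable_iff_integrableOn_Ioc_of_le hR]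
  exact intervalIntegral.integrableOn_deriv_of_nonneg (aux_cont s hs R)
    (fun r hr => aux_hasDeriv_log s hs r hr.1) (fun r _ => by positivity)

lemma aux_int_s18 (s : ℝ) (hs : 1 < s) (R : ℝ) (hR : s ≤ R) :
    ∫ r in s..R, 1 / Real.sqrt (r ^ 2 - s ^ 2)
      = Real.log (R + Real.sqrt (R ^ 2 - s ^ 2)) - Real.log s := by
  rw [intervalIntegral.integral_eq_sub_of_hasDerivAt_of_le hR (aux_cont s hs R)
    (fun r hr => aux_hasDeriv_log s hs r hr.1) (aux_ii s hs R hR)]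
  simp

open Real Filter Topology MeasureTheory

/-- For d ≥ 4 and s > 1: (i) the subtracted integrand is integrable on
(s,∞); (ii) the truncated geodesic length minus 2·ln R converges as R → ∞ to
2·ln(2/s) + 2·∫_s^∞ [r^{(d−1)/2}/√((r²−s²)(r^{d−1}−1)) − 1/√(r²−s²)] dr. -/
theorem stmt_18 (d : ℕ) (hd : 4 ≤ d) (s : ℝ) (hs : 1 < s) :
    IntegrableOn
      (fun r : ℝ => r ^ (((d : ℝ) - 1) / 2)
          / Real.sqrt ((r ^ 2 - s ^ 2) * (r ^ (d - 1) - 1))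
        - 1 / Real.sqrt (r ^ 2 - s ^ 2))
      (Set.Ioi s) ∧
    Tendsto (fun R : ℝ =>
        2 * (∫ r in s..R, r ^ (((d : ℝ) - 1) / 2)
            / Real.sqrt ((r ^ 2 - s ^ 2) * (r ^ (d - 1) - 1)))
          - 2 * Real.log R)
      atTop
      (nhds (2 * Real.log (2 / s)
        + 2 * ∫ r in Set.Ioi s, (r ^ (((d : ℝ) - 1) / 2)
            / Real.sqrt ((r ^ 2 - s ^ 2) * (r ^ (d - 1) - 1))
          - 1 / Real.sqrt (r ^ 2 - s ^ 2)))) := by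
  have hint := aux_integrable d hd s hs
  refine ⟨hint, ?_⟩
  have h1 := intervalIntegral_tendsto_integral_Ioi s hint tendsto_id
  have h2 : Tendsto (fun R : ℝ => Real.log (1 + Real.sqrt (R ^ 2 - s ^ 2) / R) - Real.log s)
      atTop (𝓝 (Real.log (2 / s))) := by
    rw [Real.log_div (by norm_num) (by linarith)]
    refine Tendsto.sub_const ?_ _
    have := ((aux_tendsto_quot s hs).const_add 1).log (by norm_num)
    norm_num at this
    exact this
  refine ((h2.const_mul 2).add (h1.const_mul 2)).congr' ?_
  filter_upwards [eventually_gt_atTop s] with R hR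
  have hR0 : 0 < R := by linarith
  have hg := aux_ii s hs R hR.le
  have hdiff : IntervalIntegrable (fun r : ℝ => r ^ (((d : ℝ) - 1) / 2)
          / Real.sqrt ((r ^ 2 - s ^ 2) * (r ^ (d - 1) - 1))
        - 1 / Real.sqrt (r ^ 2 - s ^ 2)) volume s R := by
    rw [intervalIntegrable_iff_integrableOn_Ioc_of_le hR.le]
    exact hint.mono_set Set.Ioc_subset_Ioi_self
  have hadd := intervalIntegral.integral_add hdiff hg
  simp only [sub_add_cancel] at hadd
  have e : 1 + Real.sqrt (R ^ 2 - s ^ 2) / R = (R + Real.sqrt (R ^ 2 - s ^ 2)) / R := by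
    field_simp
  have hne : R + Real.sqrt (R ^ 2 - s ^ 2) ≠ 0 := by
    have := Real.sqrt_nonneg (R ^ 2 - s ^ 2)
    linarith
  rw [hadd, aux_int_s18 s hs R hR.le, e, Real.log_div hne hR0.ne']
  simp only [id]
  ring
end

section
/- Let d > 3 be an integer, let β > 0 and a > 0, and fix (τ, x, y⃗) ∈ ℝ × ℝ × ℝ^{d−3}. Define G̃₀(τ, x, y⃗) = (τ² + x² + |y⃗|²)^{-(d−3)/2}, and assume that (τ + mβ)² + (x + na)² + |y⃗|² > 0 for all (m, n) ∈ ℤ². Then the family indexed by (m, n) ∈ ℤ² \ {(0,0)} with terms ½·G̃₀(τ + mβ, x + na, y⃗) + ½·G̃₀(τ − mβ, x − na, y⃗) − G̃₀(mβ, na, 0⃗) is absolutely summable. -/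
open Real

section helpers
open Filter Topology Asymptotics

lemma taylor_aux (s : ℝ) : ∃ C > 0, ∃ δ > 0, δ < 1 ∧ ∀ u : ℝ, |u| < δ → |(1+u)^(-s) - 1 + s*u| ≤ C * u^2 := by
  have h := (Real.one_add_rpow_hasFPowerSeriesAt_zero (a := -s)).isBigO_sub_partialSum_pow 2
  simp [FormalMultilinearSeries.partialSum, Finset.sum_range_succ, binomialSeries] at h
  obtain ⟨C, hC, h⟩ := h.exists_pos
  rw [IsBigOWith, Metric.eventually_nhds_iff] at h
  obtain ⟨e, he, h⟩ := h
  refine ⟨C, hC, min e (1/2), by positivity, by norm_num, fun u hu => ?_⟩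
  have := h (y := u) (by simpa using (lt_min_iff.1 hu).1)
  simp at this
  convert this using 2
  ring

lemma summ_aux : Summable (fun q : ℤ × ℤ => (‖q‖ : ℝ) ^ (-3:ℝ)) := by
  have := EisensteinSeries.summable_one_div_norm_rpow (k := 3) (by norm_num)
  rw [← (finTwoArrowEquiv _).symm.summable_iff] at this
  convert this using 2 with q
  simp [Function.comp, EisensteinSeries.norm_eq_max_natAbs, Prod.norm_def, Int.norm_eq_abs]

lemma tt_aux : Tendsto (fun q : ℤ × ℤ => ‖q‖) cofinite atTop := by
  rw [← cocompact_eq_cofinite]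
  exact tendsto_norm_cocompact_atTop

lemma aux_bound_s19 (s : ℝ) (hs : 1 / 2 ≤ s) (β a : ℝ) (hβ : 0 < β) (ha : 0 < a) (τ x Y : ℝ)
    (hY : 0 ≤ Y) :
    Summable (fun q : ℤ × ℤ =>
      |(1 / 2) * ((τ + (q.1 : ℝ) * β) ^ 2 + (x + (q.2 : ℝ) * a) ^ 2 + Y) ^ (-s)
        + (1 / 2) * ((τ - (q.1 : ℝ) * β) ^ 2 + (x - (q.2 : ℝ) * a) ^ 2 + Y) ^ (-s)
        - (((q.1 : ℝ) * β) ^ 2 + ((q.2 : ℝ) * a) ^ 2) ^ (-s)|) := by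
  obtain ⟨C, hC, δ, hδ, hδ1, hT⟩ := taylor_aux s
  obtain ⟨c, hc, hcβ, hca⟩ : ∃ c : ℝ, 0 < c ∧ c ≤ β ^ 2 ∧ c ≤ a ^ 2 :=
    ⟨min (β ^ 2) (a ^ 2), by positivity, min_le_left _ _, min_le_right _ _⟩
  obtain ⟨S, hS⟩ : ∃ S, S = τ ^ 2 + x ^ 2 + Y := ⟨_, rfl⟩
  have hS0 : 0 ≤ S := by rw [hS]; positivity
  obtain ⟨M, hM⟩ : ∃ M, M = β * |τ| + a * |x| := ⟨_, rfl⟩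
  have hM0 : 0 ≤ M := by rw [hM]; positivity
  obtain ⟨K, hK⟩ : ∃ K, K = (2 * M + S) / c := ⟨_, rfl⟩
  have hK0 : 0 ≤ K := by rw [hK]; positivity
  refine summable_of_isBigO summ_aux (IsBigO.of_bound (c ^ (-s) * (C * K ^ 2 + s * (S / c))) ?_)
  filter_upwards [tt_aux.eventually_ge_atTop 1, tt_aux.eventually_gt_atTop (K / δ)] with q hN1 hNK
  obtain ⟨m, n⟩ := q
  obtain ⟨N, hN⟩ : ∃ N, N = ‖((m, n) : ℤ × ℤ)‖ := ⟨_, rfl⟩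
  rw [← hN] at hN1 hNK ⊢
  have hN0 : 0 < N := by linarith
  have hNmax : N = max |(m : ℝ)| |(n : ℝ)| := by
    rw [hN, Prod.norm_def]; simp [Int.norm_eq_abs]
  have hm : |(m : ℝ)| ≤ N := hNmax ▸ le_max_left _ _
  have hn : |(n : ℝ)| ≤ N := hNmax ▸ le_max_right _ _
  have hNsq : N ^ 2 ≤ (m : ℝ) ^ 2 + (n : ℝ) ^ 2 := by
    rcases max_choice |(m : ℝ)| |(n : ℝ)| with h | h <;> rw [hNmax, h, sq_abs] <;>
      nlinarith [sq_nonneg (m : ℝ), sq_nonneg (n : ℝ)]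
  dsimp only
  generalize (m : ℝ) = m at *
  generalize (n : ℝ) = n at *
  obtain ⟨R, hR⟩ : ∃ R, R = (m * β) ^ 2 + (n * a) ^ 2 := ⟨_, rfl⟩
  have hRN : c * N ^ 2 ≤ R := by
    rw [hR]
    nlinarith [mul_le_mul_of_nonneg_right hcβ (sq_nonneg m),
      mul_le_mul_of_nonneg_right hca (sq_nonneg n)]
  have hR0 : 0 < R := lt_of_lt_of_le (by positivity) hRN
  obtain ⟨L, hL⟩ : ∃ L, L = m * β * τ + n * a * x := ⟨_, rfl⟩
  have hLN : |L| ≤ M * N := by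
    rw [hL, hM]
    calc |m * β * τ + n * a * x| ≤ |m * β * τ| + |n * a * x| := abs_add_le _ _
      _ = |m| * (β * |τ|) + |n| * (a * |x|) := by
        simp only [abs_mul, abs_of_pos hβ, abs_of_pos ha]; ring
      _ ≤ N * (β * |τ|) + N * (a * |x|) := by gcongr
      _ = _ := by ring
  have hu : ∀ L', |L'| ≤ M * N → |(2 * L' + S) / R| ≤ K / N := by
    intro L' h
    rw [abs_div, abs_of_pos hR0]
    calc |2 * L' + S| / R ≤ ((2 * M + S) * N) / (c * N ^ 2) := by
          gcongr
          calc |2 * L' + S| ≤ |2 * L'| + |S| := abs_add_le _ _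
            _ = 2 * |L'| + S := by rw [abs_mul, abs_of_nonneg hS0]; norm_num
            _ ≤ _ := by nlinarith
      _ = K / N := by rw [hK]; field_simp
  have hKδ : K / N < δ := by
    rw [div_lt_iff₀ hδ] at hNK
    rw [div_lt_iff₀ hN0]; linarith
  have hE : ∀ L', |L'| ≤ M * N → ∃ e, |e| ≤ C * (K / N) ^ 2 ∧
      (R + 2 * L' + S) ^ (-s) = R ^ (-s) * (1 - s * ((2 * L' + S) / R) + e) := by
    intro L' h
    have h1 := hu L' h
    have h2 := hT _ (lt_of_le_of_lt h1 hKδ)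
    refine ⟨_, h2.trans ?_, ?_⟩
    · rw [← sq_abs]; gcongr
    · have : R + 2 * L' + S = R * (1 + (2 * L' + S) / R) := by field_simp; ring
      have h3 := (abs_lt.1 (lt_of_le_of_lt h1 hKδ)).1
      rw [this, Real.mul_rpow hR0.le (by linarith)]
      ring
  obtain ⟨e1, he1, h1⟩ := hE L hLN
  obtain ⟨e2, he2, h2⟩ := hE (-L) (by rwa [abs_neg])
  have e1' : (τ + m * β) ^ 2 + (x + n * a) ^ 2 + Y = R + 2 * L + S := by
    rw [hR, hL, hS]; ring
  have e2' : (τ - m * β) ^ 2 + (x - n * a) ^ 2 + Y = R + 2 * (-L) + S := by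
    rw [hR, hL, hS]; ring
  rw [e1', e2', ← hR, h1, h2]
  have hs0 : 0 < s := by linarith
  have hRs : R ^ (-s) ≤ c ^ (-s) * N⁻¹ := by
    calc R ^ (-s) ≤ (c * N ^ 2) ^ (-s) :=
          Real.rpow_le_rpow_of_nonpos (by positivity) hRN (by linarith)
      _ = c ^ (-s) * (N ^ 2) ^ (-s) := Real.mul_rpow hc.le (by positivity)
      _ ≤ c ^ (-s) * N⁻¹ := by
        gcongr
        rw [← Real.rpow_natCast, ← Real.rpow_mul hN0.le, ← Real.rpow_neg_one]
        apply Real.rpow_le_rpow_of_exponent_le hN1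
        push_cast; linarith
  have key : (1 / 2) * (R ^ (-s) * (1 - s * ((2 * L + S) / R) + e1))
      + (1 / 2) * (R ^ (-s) * (1 - s * ((2 * (-L) + S) / R) + e2)) - R ^ (-s)
      = R ^ (-s) * ((e1 + e2) / 2 - s * (S / R)) := by
    field_simp; ring
  rw [key, Real.norm_eq_abs, abs_abs, Real.norm_eq_abs, abs_mul,
    abs_of_nonneg (Real.rpow_nonneg hR0.le _), abs_of_nonneg (Real.rpow_nonneg hN0.le _)]
  have hbr : |(e1 + e2) / 2 - s * (S / R)| ≤ (C * K ^ 2 + s * (S / c)) * (N ^ 2)⁻¹ := by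
    have hSR : s * (S / R) ≤ s * (S / c) * (N ^ 2)⁻¹ := by
      calc s * (S / R) ≤ s * (S / (c * N ^ 2)) := by gcongr
        _ = _ := by field_simp
    have hSR0 : 0 ≤ s * (S / R) := by positivity
    have hCK : C * (K / N) ^ 2 = C * K ^ 2 * (N ^ 2)⁻¹ := by field_simp
    rw [hCK] at he1 he2
    rw [abs_le] at he1 he2 ⊢
    constructor <;> linarith [he1.1, he1.2, he2.1, he2.2]
  have hN3 : N ^ (-3 : ℝ) = N⁻¹ * (N ^ 2)⁻¹ := by
    rw [Real.rpow_neg hN0.le, show (3 : ℝ) = ((3 : ℕ) : ℝ) by norm_num, Real.rpow_natCast]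
    field_simp
  rw [hN3]
  calc _ ≤ (c ^ (-s) * N⁻¹) * ((C * K ^ 2 + s * (S / c)) * (N ^ 2)⁻¹) := by gcongr
    _ = _ := by ring

end helpers

/-- With G̃₀(τ,x,y⃗) = (τ² + x² + |y⃗|²)^{-(d−3)/2}, the family indexed by
(m,n) ∈ ℤ²∖{(0,0)} with terms
½·G̃₀(τ+mβ, x+na, y⃗) + ½·G̃₀(τ−mβ, x−na, y⃗) − G̃₀(mβ, na, 0⃗)
is absolutely summable. -/
theorem stmt_19 (d : ℕ) (hd : 3 < d) (β a : ℝ) (hβ : 0 < β) (ha : 0 < a)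
    (τ x : ℝ) (y : Fin (d - 3) → ℝ)
    (hpos : ∀ m n : ℤ,
      0 < (τ + (m : ℝ) * β) ^ 2 + (x + (n : ℝ) * a) ^ 2 + ∑ i, (y i) ^ 2) :
    Summable (fun q : {q : ℤ × ℤ // q ≠ (0, 0)} =>
      |(1 / 2) * ((τ + (q.1.1 : ℝ) * β) ^ 2 + (x + (q.1.2 : ℝ) * a) ^ 2
            + ∑ i, (y i) ^ 2) ^ (-(((d : ℝ) - 3) / 2))
        + (1 / 2) * ((τ - (q.1.1 : ℝ) * β) ^ 2 + (x - (q.1.2 : ℝ) * a) ^ 2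
            + ∑ i, (y i) ^ 2) ^ (-(((d : ℝ) - 3) / 2))
        - (((q.1.1 : ℝ) * β) ^ 2 + ((q.1.2 : ℝ) * a) ^ 2) ^ (-(((d : ℝ) - 3) / 2))|) := by
  have h3 : (4 : ℝ) ≤ d := by exact_mod_cast hd
  exact (aux_bound_s19 (((d : ℝ) - 3) / 2) (by linarith) β a hβ ha τ x (∑ i, (y i) ^ 2)
    (Finset.sum_nonneg fun i _ => sq_nonneg _)).subtype {q : ℤ × ℤ | q ≠ (0, 0)}
end
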